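/- There exist absolute constants c, C > 0 such that the following holds. Let (Ω, μ) be a probability space, let n ≥ 16 be an even integer, and let (φ_j)_{j=1}^n be an orthonormal system in L₂(Ω, μ) (complex-valued) with ‖φ_j‖_{L∞} ≤ L for all 1 ≤ j ≤ n. Then there exists a subset I ⊆ {1, …, n} with n/2 − c·√n ≤ |I| ≤ n/2 + c·√n such that for every a = (a_i) ∈ ℂⁿ, both ‖∑_{i ∈ I} a_i φ_i‖_{L₂} ≤ C·L·√(log n)·(log log n)^{5/2}·‖∑_{i ∈ I} a_i φ_i‖_{L₁} and ‖∑_{i ∉ I} a_i φ_i‖_{L₂} ≤ C·L·√(log n)·(log log n)^{5/2}·‖∑_{i ∉ I} a_i φ_i‖_{L₁}. -/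

import Mathlib

open MeasureTheory
set_option linter.unusedSectionVars false

/-- sign attached to a boolean -/
noncomputable def bsg (b : Bool) : ℝ := if b then 1 else -1

theorem sum_exp_signs {n : ℕ} (v : Fin n → ℝ) :
    ∑ p : Fin n → Bool, Real.exp (∑ i, bsg (p i) * v i) ≤ 2 ^ n * Real.exp ((∑ i, (v i)^2) / 2) := by
  have h1 : ∑ p : Fin n → Bool, Real.exp (∑ i, bsg (p i) * v i)
      = ∏ i, ∑ b : Bool, Real.exp (bsg b * v i) := by
    rw [Finset.prod_univ_sum]
    rw [Fintype.piFinset_univ]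
    simp only [Real.exp_sum]
  rw [h1]
  have h2 : ∀ i, ∑ b : Bool, Real.exp (bsg b * v i) ≤ 2 * Real.exp ((v i)^2/2) := by
    intro i
    have := Real.cosh_le_exp_half_sq (v i)
    rw [Real.cosh_eq] at this
    simp only [Fintype.sum_bool, bsg]
    simp
    linarith
  calc _ ≤ ∏ i, 2 * Real.exp ((v i)^2/2) :=
        Finset.prod_le_prod (fun i _ => Finset.sum_nonneg (fun b _ => (Real.exp_pos _).le)) (fun i _ => h2 i)
    _ = _ := by
        rw [Finset.prod_mul_distrib, ← Real.exp_sum]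
        simp [Finset.sum_div]

theorem bad_signs {n : ℕ} (v : Fin n → ℝ) (h : ℝ) (hh : 0 ≤ h) :
    ((Finset.univ.filter (fun p : Fin n → Bool =>
      h * Real.sqrt (∑ i, (v i)^2) < |∑ i, bsg (p i) * v i|)).card : ℝ)
      ≤ 2 ^ n * (2 * Real.exp (-h^2/2)) := by
  set V := ∑ i, (v i)^2 with hV
  have hV0 : 0 ≤ V := Finset.sum_nonneg (fun i _ => sq_nonneg _)
  rcases hV0.eq_or_lt with h0 | hpos
  · have hv : ∀ i, v i = 0 := by
      intro i
      have := (Finset.sum_eq_zero_iff_of_nonneg (fun i _ => sq_nonneg (v i))).1 h0.symm i (Finset.mem_univ i)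
      simpa using this
    have : (Finset.univ.filter (fun p : Fin n → Bool =>
      h * Real.sqrt V < |∑ i, bsg (p i) * v i|)) = ∅ := by
      rw [Finset.filter_eq_empty_iff]
      intro p _
      simp [← h0, hv]
    rw [this]; simp; positivity
  · have hs : 0 < Real.sqrt V := Real.sqrt_pos.2 hpos
    set t := h / Real.sqrt V with ht
    have ht0 : 0 ≤ t := by positivity
    have htV : t^2 * V = h^2 := by
      rw [ht, div_pow, Real.sq_sqrt hV0]; field_simp
    have e1 := sum_exp_signs (fun i => t * v i)
    have e2 := sum_exp_signs (fun i => -(t * v i))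
    have hq : ∑ i, (t * v i)^2 = h^2 := by
      simp only [mul_pow, ← Finset.mul_sum]; exact htV
    simp only [neg_sq] at e2
    rw [hq] at e1 e2
    have key : ((Finset.univ.filter (fun p : Fin n → Bool =>
      h * Real.sqrt V < |∑ i, bsg (p i) * v i|)).card : ℝ) * Real.exp (h^2) ≤
        ∑ p : Fin n → Bool, (Real.exp (∑ i, bsg (p i) * (t * v i)) + Real.exp (∑ i, bsg (p i) * (-(t * v i)))) := by
      rw [← nsmul_eq_mul]
      refine (Finset.card_nsmul_le_sum _ _ _ ?_).trans (Finset.sum_le_sum_of_subset_of_nonneg (Finset.filter_subset _ _) (fun p _ _ => by positivity))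
      intro p hp
      simp only [Finset.mem_filter, Finset.mem_univ, true_and] at hp
      have a1 : ∑ i, bsg (p i) * (t * v i) = t * ∑ i, bsg (p i) * v i := by
        rw [Finset.mul_sum]; exact Finset.sum_congr rfl (fun i _ => by ring)
      have a2 : ∑ i, bsg (p i) * (-(t * v i)) = t * -∑ i, bsg (p i) * v i := by
        rw [← Finset.sum_neg_distrib, Finset.mul_sum]; exact Finset.sum_congr rfl (fun i _ => by ring)
      rw [a1, a2]
      have hle : h^2 ≤ t * |∑ i, bsg (p i) * v i| := by
        have := mul_le_mul_of_nonneg_left hp.le ht0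
        calc h^2 = t * (h * Real.sqrt V) := by rw [ht]; field_simp
          _ ≤ _ := this
      rcases abs_cases (∑ i, bsg (p i) * v i) with ⟨h1, _⟩ | ⟨h1, _⟩
      · rw [h1] at hle
        have := Real.exp_le_exp.2 hle
        have := Real.exp_pos (t * -∑ i, bsg (p i) * v i)
        linarith
      · rw [h1] at hle
        have := Real.exp_le_exp.2 hle
        have := Real.exp_pos (t * ∑ i, bsg (p i) * v i)
        linarith
    rw [Finset.sum_add_distrib] at key
    have hE : Real.exp (-h^2/2) * Real.exp (h^2) = Real.exp (h^2/2) := by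
      rw [← Real.exp_add]; congr 1; ring
    have hp := Real.exp_pos (h^2)
    rw [← mul_le_mul_iff_left₀ hp]
    calc _ ≤ _ := key
      _ ≤ 2 ^ n * (2 * Real.exp (h^2/2)) := by linarith
      _ = _ := by rw [← hE]; ring

/-- existence of good signs for a finite family of vectors -/
theorem sign_exists {E : Type*} [Fintype E] {n : ℕ} (v : E → Fin n → ℝ) (h : E → ℝ)
    (hh : ∀ e, 0 ≤ h e)
    (hsum : ∑ e, 2 * Real.exp (-(h e)^2/2) < 1) :
    ∃ ε : Fin n → ℝ, (∀ i, ε i = 1 ∨ ε i = -1) ∧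
      ∀ e, |∑ i, ε i * v e i| ≤ h e * Real.sqrt (∑ i, (v e i)^2) := by
  classical
  by_contra hcon
  push Not at hcon
  have hall : ∀ p : Fin n → Bool, ∃ e, h e * Real.sqrt (∑ i, (v e i)^2) < |∑ i, bsg (p i) * v e i| := by
    intro p
    exact hcon (fun i => bsg (p i)) (fun i => by unfold bsg; cases p i <;> simp)
  have hsub : (Finset.univ : Finset (Fin n → Bool)) ⊆ Finset.univ.biUnion (fun e : E =>
      Finset.univ.filter (fun p : Fin n → Bool =>
        h e * Real.sqrt (∑ i, (v e i)^2) < |∑ i, bsg (p i) * v e i|)) := by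
    intro p _
    obtain ⟨e, he⟩ := hall p
    simp only [Finset.mem_biUnion, Finset.mem_filter, Finset.mem_univ, true_and]
    exact ⟨e, he⟩
  have hc := (Finset.card_le_card hsub).trans Finset.card_biUnion_le
  have hc' : (2:ℝ)^n ≤ ∑ e, 2 ^ n * (2 * Real.exp (-(h e)^2/2)) := by
    have : ((Finset.univ : Finset (Fin n → Bool)).card : ℝ) = 2^n := by simp
    rw [← this]
    refine (Nat.cast_le.2 hc).trans ?_
    push_cast
    exact (Finset.sum_le_sum (fun e _ => bad_signs (v e) (h e) (hh e))).trans (by simp)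
  rw [← Finset.mul_sum] at hc'
  have : (0:ℝ) < 2^n := by positivity
  nlinarith

theorem chain_sum_small (b : ℝ) (hb : 1 ≤ b) (N : ℕ) (M : ℕ → ℕ)
    (hM : ∀ k, (M k : ℝ) ≤ Real.exp (b * 4 ^ k)) :
    ∑ k ∈ Finset.range N, (M k : ℝ) * (M (k+1)) * (2 * Real.exp (-(4 * Real.sqrt b * 2^k)^2/2)) ≤ 2/7 := by
  have h1 : ∀ k, (M k : ℝ) * (M (k+1)) * (2 * Real.exp (-(4 * Real.sqrt b * 2^k)^2/2)) ≤ 2 * (1/8)^(k+1) := by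
    intro k
    have e1 : (4 * Real.sqrt b * 2^k)^2/2 = 8 * b * 4^k := by
      rw [mul_pow, mul_pow, Real.sq_sqrt (by linarith), ← pow_mul, mul_comm k 2, pow_mul]; norm_num; ring
    have e2 : (M k : ℝ) * (M (k+1)) ≤ Real.exp (5 * b * 4^k) := by
      calc _ ≤ Real.exp (b * 4^k) * Real.exp (b * 4^(k+1)) :=
            mul_le_mul (hM k) (hM (k+1)) (by positivity) (by positivity)
        _ = _ := by rw [← Real.exp_add]; congr 1; ring
    have e3 : (k:ℝ) + 1 ≤ b * 4^k := by
      have : ((k:ℝ)+1) ≤ 4^k := by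
        have : k + 1 ≤ 4^k := Nat.lt_pow_self (by norm_num)
        exact_mod_cast this
      have h4 : (0:ℝ) < 4^k := by positivity
      nlinarith
    have e4 : Real.exp (-3) ≤ 1/8 := by
      rw [Real.exp_neg]
      have : (8:ℝ) ≤ Real.exp 3 := by
        have := Real.exp_one_gt_d9
        have h3 : Real.exp 3 = Real.exp 1 ^ 3 := by rw [← Real.exp_nat_mul]; norm_num
        rw [h3]
        calc (8:ℝ) = 2^3 := by norm_num
          _ ≤ _ := by gcongr; linarith
      rw [one_div]; gcongr
    calc _ ≤ Real.exp (5 * b * 4^k) * (2 * Real.exp (-(4 * Real.sqrt b * 2^k)^2/2)) := by gcongr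
      _ = 2 * Real.exp (-3 * (b * 4^k)) := by
          rw [neg_div, e1, mul_left_comm, ← Real.exp_add]; congr 2; ring
      _ ≤ 2 * Real.exp (((k+1:ℕ):ℝ) * (-3)) := by
          have := Real.exp_le_exp.2 (show -3 * (b * 4^k) ≤ ((k+1:ℕ):ℝ) * (-3) by push_cast; linarith)
          linarith
      _ = 2 * Real.exp (-3) ^ (k+1) := by rw [Real.exp_nat_mul]
      _ ≤ _ := by gcongr
  calc _ ≤ ∑ k ∈ Finset.range N, 2 * (1/8:ℝ)^(k+1) := Finset.sum_le_sum (fun k _ => h1 k)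
    _ = 2/7 * (1 - (1/8)^N) := by
        induction N with
        | zero => simp
        | succ k ih => rw [Finset.sum_range_succ, ih]; ring
    _ ≤ _ := by have : (0:ℝ) ≤ (1/8)^N := by positivity
                linarith

theorem sign_norm_bound {n : ℕ} (ε : Fin n → ℝ) (hε : ∀ i, ε i = 1 ∨ ε i = -1)
    (v : EuclideanSpace ℝ (Fin n)) : |∑ i, ε i * v i| ≤ Real.sqrt n * ‖v‖ := by
  have h1 : ∑ i, ε i ^ 2 = n := by
    have : ∀ i, ε i ^ 2 = 1 := fun i => by rcases hε i with h | h <;> rw [h] <;> norm_num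
    simp [this]
  have := Finset.sum_mul_sq_le_sq_mul_sq Finset.univ ε (fun i => v i)
  rw [h1] at this
  rw [EuclideanSpace.norm_eq, ← Real.sqrt_mul (by positivity)]
  apply Real.abs_le_sqrt
  simpa using this

theorem chaining {T : Type*} {n Nl : ℕ} (y : T → EuclideanSpace ℝ (Fin n)) (t0 : T) (ht0 : y t0 = 0)
    (M : ℕ → ℕ) (c : ℕ → T → ℕ) (hc : ∀ k f, c k f < M k) (D : ℕ → T → ℝ)
    (hD : ∀ k f g, c k f = c k g → ‖y f - y g‖ ≤ D k f)
    (b : ℝ) (hb : 1 ≤ b) (hM : ∀ k, (M k : ℝ) ≤ Real.exp (b * 4 ^ k)) (h0 : M 0 = 1)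
    (hn : n ≤ 4 ^ Nl) :
    ∃ ε : Fin n → ℝ, (∀ i, ε i = 1 ∨ ε i = -1) ∧ |∑ i, ε i| ≤ 2 * Real.sqrt n ∧
      ∀ f, |∑ i, ε i * y f i| ≤ 7 * Real.sqrt b * ∑ k ∈ Finset.range (Nl + 1), 2 ^ k * D k f := by
  classical
  have hrep : ∃ p : ℕ → ℕ → T, (∀ k f, c k (p k (c k f)) = c k f) ∧ ∀ j, p 0 j = t0 := by
    refine ⟨fun k j => if k = 0 then t0 else if h : ∃ f, c k f = j then h.choose else t0, ?_, ?_⟩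
    · intro k f
      rcases Nat.eq_zero_or_pos k with hk | hk
      · subst hk
        have a := hc 0 f
        have a2 := hc 0 t0
        simp only [if_true]
        rw [h0] at a a2
        omega
      · have hex : ∃ g, c k g = c k f := ⟨f, rfl⟩
        simp only [hk.ne', if_false, dif_pos hex]
        exact hex.choose_spec
    · simp
  obtain ⟨p, hp, hp0⟩ := hrep
  let E := Option (Σ k : Fin Nl, Fin (M k) × Fin (M (k+1)))
  let v : E → Fin n → ℝ := fun e => match e with
    | none => fun _ => 1
    | some ⟨k, i, j⟩ => fun l => (y (p k i) - y (p (k+1) j)) l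
  let h : E → ℝ := fun e => match e with
    | none => 2
    | some ⟨k, i, j⟩ => 4 * Real.sqrt b * 2 ^ (k:ℕ)
  obtain ⟨ε, hε, hεv⟩ := sign_exists v h
    (by rintro (_ | ⟨k, i, j⟩) <;> simp only [h] <;> positivity) (by
      rw [Fintype.sum_option, Fintype.sum_sigma]
      simp only [h, Finset.sum_const, Finset.card_univ, Fintype.card_prod, Fintype.card_fin, nsmul_eq_mul]
      have := chain_sum_small b hb Nl M hM
      rw [Finset.sum_range] at this
      push_cast
      have e2 : Real.exp (-2^2/2) < 1/4 := by
        have := Real.exp_one_gt_d9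
        have h3 : Real.exp (-2^2/2) = (Real.exp 1 ^ 2)⁻¹ := by
          rw [← Real.exp_nat_mul, ← Real.exp_neg]; norm_num
        rw [h3, one_div]
        gcongr
        nlinarith
      linarith)
  refine ⟨ε, hε, ?_, ?_⟩
  · have := hεv none
    simpa [v, h] using this
  · intro f
    set q : ℕ → T := fun k => p k (c k f) with hq
    have hqD : ∀ k, ‖y f - y (q k)‖ ≤ D k f := fun k => hD k f _ (hp k f).symm
    have hDnn : ∀ k, 0 ≤ D k f := fun k => (norm_nonneg _).trans (hqD k)
    have hsb : 0 ≤ Real.sqrt b := Real.sqrt_nonneg b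
    have hsb1 : 1 ≤ Real.sqrt b := Real.one_le_sqrt.2 hb
    have step : ∀ k < Nl, |∑ i, ε i * (y (q k) - y (q (k+1))) i| ≤
        4 * Real.sqrt b * 2^k * (D k f + D (k+1) f) := by
      intro k hk
      have := hεv (some ⟨⟨k, hk⟩, ⟨c k f, hc k f⟩, ⟨c (k+1) f, hc (k+1) f⟩⟩)
      simp only [v, h] at this
      refine this.trans ?_
      gcongr
      have e : Real.sqrt (∑ i, ((y (q k) - y (q (k+1))) i)^2) = ‖y (q k) - y (q (k+1))‖ := by
        rw [EuclideanSpace.norm_eq]; simp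
      have e2 : Real.sqrt (∑ i, ((y (q k) - y (q (k+1))) i)^2) ≤ D k f + D (k+1) f := by
        rw [e]
        calc _ = ‖(y f - y (q (k+1))) - (y f - y (q k))‖ := by congr 1; abel
          _ ≤ ‖y f - y (q (k+1))‖ + ‖y f - y (q k)‖ := norm_sub_le _ _
          _ ≤ _ := by linarith [hqD k, hqD (k+1)]
      exact e2
    have main : ∀ K ≤ Nl, |∑ i, ε i * (y (q K)) i| ≤
        ∑ k ∈ Finset.range K, 4 * Real.sqrt b * 2^k * (D k f + D (k+1) f) := by
      intro K
      induction K with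
      | zero => intro _; simp [hq, hp0, ht0]
      | succ K ih =>
        intro hK
        rw [Finset.sum_range_succ]
        have e : ∑ i, ε i * (y (q (K+1))) i = ∑ i, ε i * (y (q K)) i - ∑ i, ε i * (y (q K) - y (q (K+1))) i := by
          rw [← Finset.sum_sub_distrib]
          exact Finset.sum_congr rfl (fun i _ => by simp only [PiLp.sub_apply]; ring)
        rw [e]
        refine (abs_sub _ _).trans ?_
        exact add_le_add (ih (by omega)) (step K (by omega))
    have tail : |∑ i, ε i * (y f - y (q Nl)) i| ≤ 2^Nl * D Nl f := by
      refine (sign_norm_bound ε hε _).trans ?_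
      refine mul_le_mul ?_ (hqD Nl) (norm_nonneg _) (by positivity)
      apply Real.sqrt_le_iff.2 ⟨by positivity, ?_⟩
      rw [← pow_mul, mul_comm, pow_mul]
      norm_num
      exact_mod_cast hn
    have e : ∑ i, ε i * (y f) i = ∑ i, ε i * (y (q Nl)) i + ∑ i, ε i * (y f - y (q Nl)) i := by
      rw [← Finset.sum_add_distrib]
      exact Finset.sum_congr rfl (fun i _ => by simp only [PiLp.sub_apply]; ring)
    rw [e]
    refine (abs_add_le _ _).trans ((add_le_add (main Nl le_rfl) tail).trans ?_)
    have s1 : ∑ k ∈ Finset.range Nl, 4 * Real.sqrt b * 2^k * (D k f + D (k+1) f)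
        = 4 * Real.sqrt b * ∑ k ∈ Finset.range Nl, 2^k * D k f
          + 2 * Real.sqrt b * ∑ k ∈ Finset.range Nl, 2^(k+1) * D (k+1) f := by
      rw [Finset.mul_sum, Finset.mul_sum, ← Finset.sum_add_distrib]
      exact Finset.sum_congr rfl (fun i _ => by ring)
    have s2 : ∑ k ∈ Finset.range Nl, 2^k * D k f ≤ ∑ k ∈ Finset.range (Nl+1), 2^k * D k f := by
      rw [Finset.sum_range_succ]
      have : 0 ≤ 2^Nl * D Nl f := mul_nonneg (by positivity) (hDnn _)
      linarith
    have s3 : ∑ k ∈ Finset.range Nl, 2^(k+1) * D (k+1) f ≤ ∑ k ∈ Finset.range (Nl+1), 2^k * D k f := by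
      rw [Finset.sum_range_succ']
      have : 0 ≤ 2^0 * D 0 f := mul_nonneg (by positivity) (hDnn _)
      linarith
    have s4 : 2^Nl * D Nl f ≤ ∑ k ∈ Finset.range (Nl+1), 2^k * D k f :=
      Finset.single_le_sum (f := fun k => 2^k * D k f) (fun k _ => mul_nonneg (by positivity) (hDnn _)) (by simp)
    have s5 : 0 ≤ ∑ k ∈ Finset.range (Nl+1), 2^k * D k f :=
      Finset.sum_nonneg (fun k _ => mul_nonneg (by positivity) (hDnn _))
    rw [s1]
    nlinarith [mul_le_mul_of_nonneg_left s2 hsb, mul_le_mul_of_nonneg_left s3 hsb, mul_le_mul_of_nonneg_right hsb1 s5]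

/-- `x log (x / l)` -/
noncomputable def FF (l x : ℝ) : ℝ := x * Real.log (x / l)

noncomputable def uu (l : ℝ) (z : ℂ) : ℝ := Real.sqrt (l^2 + ‖z‖^2)

/-- the convex function -/
noncomputable def hh (l : ℝ) (z : ℂ) : ℝ := FF l (uu l z)

theorem FF_lip {l x y : ℝ} (hl : 0 < l) (hx : l ≤ x) (hxy : x ≤ y) : y - x ≤ FF l y - FF l x := by
  unfold FF
  have hx0 : 0 < x := by linarith
  have hy0 : 0 < y := by linarith
  have e1 : Real.log (y / l) = Real.log (x / l) - Real.log (x / y) := by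
    rw [Real.log_div hy0.ne' hl.ne', Real.log_div hx0.ne' hl.ne', Real.log_div hx0.ne' hy0.ne']; ring
  have e2 : Real.log (x / y) ≤ x / y - 1 := Real.log_le_sub_one_of_pos (by positivity)
  have e3 : 0 ≤ Real.log (x / l) := Real.log_nonneg (by rw [le_div_iff₀ hl]; linarith)
  have e4 : y * (x / y) = x := by field_simp
  rw [e1]
  nlinarith [mul_le_mul_of_nonneg_left e2 hy0.le, mul_nonneg (sub_nonneg.2 hxy) e3]

theorem FF_mono {l x y : ℝ} (hl : 0 < l) (hx : l ≤ x) (hxy : x ≤ y) : FF l x ≤ FF l y := by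
  have := FF_lip hl hx hxy
  linarith

theorem log_lower {u A : ℝ} (hu : 0 < u) (hA : 0 < A) :
    (u - A) + (u - A)^2 / (2 * (u + A)) ≤ u * Real.log (u / A) := by
  set a := Real.sqrt u
  set b := Real.sqrt A
  have ha : 0 < a := Real.sqrt_pos.2 hu
  have hb : 0 < b := Real.sqrt_pos.2 hA
  have hua : u = a^2 := (Real.sq_sqrt hu.le).symm
  have hAb : A = b^2 := (Real.sq_sqrt hA.le).symm
  have e1 : Real.log (u / A) = - (2 * Real.log (b / a)) := by
    rw [hua, hAb, ← div_pow, Real.log_pow, Real.log_div ha.ne' hb.ne', Real.log_div hb.ne' ha.ne']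
    push_cast; ring
  have e2 : Real.log (b / a) ≤ b / a - 1 := Real.log_le_sub_one_of_pos (by positivity)
  have e3 : a^2 * (b / a) = a * b := by field_simp
  have e4 : (u - A)^2 / (2 * (u + A)) ≤ (a - b)^2 := by
    rw [div_le_iff₀ (by positivity), hua, hAb]
    nlinarith [sq_nonneg (a - b), mul_nonneg (sq_nonneg (a-b)) (sq_nonneg (a-b))]
  rw [e1]
  rw [hua, hAb] at *
  nlinarith [mul_le_mul_of_nonneg_left e2 (sq_nonneg a)]

theorem FF_conv {l u v : ℝ} (hl : 0 < l) (hu : 0 < u) (hv : 0 < v) :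
    (u - v)^2 / (6 * (u + v)) ≤ FF l u + FF l v - 2 * FF l ((u + v)/2) := by
  set A := (u+v)/2 with hA
  have hA0 : 0 < A := by positivity
  have h1 := log_lower hu hA0
  have h2 := log_lower hv hA0
  have e : FF l u + FF l v - 2 * FF l A = u * Real.log (u/A) + v * Real.log (v/A) := by
    unfold FF
    rw [Real.log_div hu.ne' hl.ne', Real.log_div hv.ne' hl.ne', Real.log_div hA0.ne' hl.ne',
      Real.log_div hu.ne' hA0.ne', Real.log_div hv.ne' hA0.ne', hA]; ring
  rw [e]
  have h3 : (u - v)^2 / (6 * (u + v)) ≤ (u - A)^2 / (2 * (u + A)) + (v - A)^2 / (2 * (v + A)) := by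
    have e1 : u - A = (u-v)/2 := by rw [hA]; ring
    have e2 : v - A = -((u-v)/2) := by rw [hA]; ring
    have g1 : (u - v)^2 / (12 * (u + v)) ≤ (u - A)^2 / (2 * (u + A)) := by
      rw [e1, div_pow, div_div]
      apply div_le_div_of_nonneg_left (sq_nonneg _) (by positivity)
      rw [hA]; linarith
    have g2 : (u - v)^2 / (12 * (u + v)) ≤ (v - A)^2 / (2 * (v + A)) := by
      rw [e2, neg_sq, div_pow, div_div]
      apply div_le_div_of_nonneg_left (sq_nonneg _) (by positivity)
      rw [hA]; linarith
    calc (u - v)^2 / (6 * (u + v)) = (u - v)^2 / (12 * (u + v)) + (u - v)^2 / (12 * (u + v)) := by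
          field_simp; ring
      _ ≤ _ := add_le_add g1 g2
  linarith

theorem uu_ge {l : ℝ} (hl : 0 < l) (z : ℂ) : l ≤ uu l z := by
  unfold uu
  apply Real.le_sqrt_of_sq_le
  nlinarith [sq_nonneg ‖z‖]

theorem uu_le {l : ℝ} (hl : 0 < l) (z : ℂ) : uu l z ≤ l + ‖z‖ := by
  unfold uu
  apply Real.sqrt_le_iff.2 ⟨by positivity, ?_⟩
  nlinarith [norm_nonneg z]

theorem uu_sq (l : ℝ) (z : ℂ) : uu l z ^ 2 = l^2 + ‖z‖^2 := by
  unfold uu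
  rw [Real.sq_sqrt (by positivity)]

theorem norm_half_sq (z w : ℂ) : ‖(z + w)/2‖^2 = (‖z‖^2 + ‖w‖^2)/2 - ‖z - w‖^2/4 := by
  have := parallelogram_law_with_norm ℝ z w
  rw [norm_div, div_pow]
  norm_num
  nlinarith

theorem hh_conv {l : ℝ} (hl : 0 < l) (z w : ℂ) :
    ‖z - w‖^2 / (6 * (2 * l + ‖z‖ + ‖w‖)) ≤ hh l z + hh l w - 2 * hh l ((z + w)/2) := by
  unfold hh
  set u := uu l z
  set v := uu l w
  set m := uu l ((z+w)/2)
  have hu : l ≤ u := uu_ge hl z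
  have hv : l ≤ v := uu_ge hl w
  have hm : l ≤ m := uu_ge hl _
  have hu2 : u ^ 2 = l^2 + ‖z‖^2 := uu_sq l z
  have hv2 : v ^ 2 = l^2 + ‖w‖^2 := uu_sq l w
  have hm2 : m ^ 2 = l^2 + ((‖z‖^2 + ‖w‖^2)/2 - ‖z - w‖^2/4) := by rw [← norm_half_sq]; exact uu_sq l _
  have hz := norm_nonneg z
  have hw := norm_nonneg w
  have hd : (‖z‖ - ‖w‖)^2 ≤ ‖z - w‖^2 := by
    have := abs_norm_sub_norm_le z w
    rw [← sq_abs]; gcongr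
  have huv : (u - v)^2 ≤ ‖z - w‖^2 := by
    refine le_trans ?_ hd
    have huz : ‖z‖ ≤ u := by nlinarith
    have hvw : ‖w‖ ≤ v := by nlinarith
    have : ‖z‖ * ‖w‖ + l^2 ≤ u * v := by
      apply le_of_sq_le_sq _ (by nlinarith)
      rw [mul_pow, hu2, hv2]
      nlinarith [sq_nonneg (l * (‖z‖ - ‖w‖))]
    nlinarith
  set A := (u+v)/2 with hA
  have hA2 : A^2 - m^2 = (‖z - w‖^2 - (u-v)^2)/4 := by rw [hA, hm2]; nlinarith
  have hAm : m ≤ A := by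
    apply le_of_sq_le_sq _ (by linarith)
    nlinarith
  have k1 := FF_lip hl hm hAm
  have k2 := FF_conv hl (show 0 < u by linarith) (show 0 < v by linarith)
  have k3 : (‖z - w‖^2 - (u-v)^2) / (2 * (u+v)) ≤ 2 * (A - m) := by
    rw [div_le_iff₀ (by linarith)]
    nlinarith
  have k4 : ‖z - w‖^2 / (6 * (u + v)) ≤ (‖z - w‖^2 - (u-v)^2) / (2 * (u+v)) + (u - v)^2 / (6 * (u + v)) := by
    have hp : 0 < u + v := by linarith
    rw [← sub_nonneg]
    have : (‖z - w‖^2 - (u-v)^2) / (2 * (u+v)) + (u - v)^2 / (6 * (u + v)) - ‖z - w‖^2 / (6 * (u + v))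
      = (‖z - w‖^2 - (u-v)^2) / (3 * (u+v)) := by field_simp; ring
    rw [this]
    exact div_nonneg (by linarith) (by linarith)
  have k5 : ‖z - w‖^2 / (6 * (2 * l + ‖z‖ + ‖w‖)) ≤ ‖z - w‖^2 / (6 * (u + v)) := by
    apply div_le_div_of_nonneg_left (sq_nonneg _) (by linarith)
    have := uu_le hl z
    have := uu_le hl w
    linarith
  linarith

theorem hh_nonneg {l : ℝ} (hl : 0 < l) (z : ℂ) : 0 ≤ hh l z := by
  have h := uu_ge hl z
  unfold hh FF
  exact mul_nonneg (by linarith) (Real.log_nonneg (by rw [le_div_iff₀ hl]; linarith))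

theorem hh_le {l s : ℝ} (hl : 0 < l) (hs : 0 < s) (z : ℂ) :
    hh l z ≤ ‖z‖ + ‖z‖ * Real.log (1 + s) + ‖z‖^2 / (l * s) := by
  unfold hh
  have h1 := FF_mono hl (uu_ge hl z) (uu_le hl z)
  refine h1.trans ?_
  unfold FF
  set y := ‖z‖ / l with hy
  have hy0 : 0 ≤ y := by positivity
  have hz : ‖z‖ = l * y := by rw [hy]; field_simp
  have e1 : (l + ‖z‖) / l = 1 + y := by rw [hz]; field_simp
  rw [e1]
  have l1 : Real.log (1 + y) ≤ y := by
    have := Real.log_le_sub_one_of_pos (show 0 < 1 + y by linarith); linarith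
  have l2 : Real.log (1 + y) ≤ Real.log (1 + s) + y / s := by
    have a1 : 1 + y ≤ (1 + s) * (1 + y / s) := by
      have : (1 + s) * (1 + y/s) = 1 + s + y + y / s := by field_simp; ring
      rw [this]
      have : 0 ≤ y / s := by positivity
      linarith
    have a2 := Real.log_le_log (by linarith) a1
    rw [Real.log_mul (by linarith) (by positivity)] at a2
    have a3 := Real.log_le_sub_one_of_pos (show 0 < 1 + y / s by positivity)
    linarith
  have e2 : ‖z‖^2 / (l * s) = l * y * (y / s) := by rw [hz]; field_simp
  rw [e2, hz]
  nlinarith [mul_le_mul_of_nonneg_left l1 hl.le, mul_le_mul_of_nonneg_left l2 (mul_nonneg hl.le hy0)]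


/-- bounded orthonormal system -/
structure Sys {Ω : Type*} [MeasurableSpace Ω] (μ : Measure Ω) {n : ℕ} (φ : Fin n → Ω → ℂ) (L : ℝ) : Prop where
  meas : ∀ j, Measurable (φ j)
  bdd : ∀ j ω, ‖φ j ω‖ ≤ L
  orth : ∀ i j, (∫ ω, (starRingEnd ℂ) (φ i ω) * φ j ω ∂μ) = if i = j then 1 else 0
  one_le : 1 ≤ L

abbrev CE (n : ℕ) := EuclideanSpace ℂ (Fin n)
abbrev RE (n : ℕ) := EuclideanSpace ℝ (Fin n)

noncomputable def ff {Ω : Type*} {n : ℕ} (φ : Fin n → Ω → ℂ) (a : CE n) (ω : Ω) : ℂ := ∑ i, a i * φ i ω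

noncomputable def N1 {Ω : Type*} [MeasurableSpace Ω] (μ : Measure Ω) {n : ℕ} (φ : Fin n → Ω → ℂ) (a : CE n) : ℝ :=
  ∫ ω, ‖ff φ a ω‖ ∂μ

section
variable {Ω : Type*} [MeasurableSpace Ω] {μ : Measure Ω} [IsProbabilityMeasure μ] {n : ℕ}
  {φ : Fin n → Ω → ℂ} {L : ℝ}

theorem ff_add (a b : CE n) (ω : Ω) : ff φ (a + b) ω = ff φ a ω + ff φ b ω := by
  simp [ff, add_mul, Finset.sum_add_distrib]

theorem ff_sub (a b : CE n) (ω : Ω) : ff φ (a - b) ω = ff φ a ω - ff φ b ω := by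
  simp [ff, sub_mul, Finset.sum_sub_distrib]

theorem ff_smul (t : ℝ) (a : CE n) (ω : Ω) : ff φ (t • a) ω = t * ff φ a ω := by
  simp [ff, Finset.mul_sum, mul_assoc]

theorem Sys.ff_meas (h : Sys μ φ L) (a : CE n) : Measurable (ff φ a) := by
  unfold ff
  exact Finset.measurable_sum _ (fun i _ => (h.meas i).const_mul _)

theorem Sys.ff_bdd (h : Sys μ φ L) (a : CE n) (ω : Ω) : ‖ff φ a ω‖ ≤ (∑ i, ‖a i‖) * L := by
  unfold ff
  refine (norm_sum_le _ _).trans ?_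
  rw [Finset.sum_mul]
  gcongr with i _
  rw [norm_mul]
  gcongr
  exact h.bdd i ω

theorem integrable_of_bdd {E : Type*} [NormedAddCommGroup E] [MeasurableSpace E] [BorelSpace E] [SecondCountableTopology E]
    {g : Ω → E} (hg : Measurable g) (C : ℝ) (hC : ∀ ω, ‖g ω‖ ≤ C) : Integrable g μ :=
  Integrable.of_bound hg.aestronglyMeasurable C (Filter.Eventually.of_forall hC)

theorem Sys.int_norm (h : Sys μ φ L) (a : CE n) : Integrable (fun ω => ‖ff φ a ω‖) μ :=
  integrable_of_bdd (h.ff_meas a).norm ((∑ i, ‖a i‖) * L) (fun ω => by simpa using h.ff_bdd a ω)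

theorem Sys.int_sq (h : Sys μ φ L) (a : CE n) : Integrable (fun ω => ‖ff φ a ω‖^2) μ :=
  integrable_of_bdd ((h.ff_meas a).norm.pow_const 2) (((∑ i, ‖a i‖) * L)^2) (fun ω => by
    simp only [norm_pow, norm_norm]
    gcongr
    exact h.ff_bdd a ω)

theorem Sys.coeff (h : Sys μ φ L) (a : CE n) (i : Fin n) :
    ∫ ω, (starRingEnd ℂ) (φ i ω) * ff φ a ω ∂μ = a i := by
  unfold ff
  simp_rw [Finset.mul_sum]
  rw [integral_finsetSum]
  · have : ∀ j, ∫ ω, (starRingEnd ℂ) (φ i ω) * (a j * φ j ω) ∂μ = a j * if i = j then 1 else 0 := by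
      intro j
      rw [← h.orth i j, ← integral_const_mul]
      congr 1; ext ω; ring
    simp [this]
  · intro j _
    refine integrable_of_bdd ?_ (L * (‖a j‖ * L)) ?_
    · exact (Complex.continuous_conj.measurable.comp (h.meas i)).mul ((h.meas j).const_mul _)
    · intro ω
      rw [norm_mul, norm_mul, RCLike.norm_conj]
      have hL := h.one_le
      have := h.bdd i ω
      have := h.bdd j ω
      gcongr

theorem Sys.coeff_le (h : Sys μ φ L) (a : CE n) (i : Fin n) : ‖a i‖ ≤ L * N1 μ φ a := by
  rw [← h.coeff a i]
  refine (norm_integral_le_integral_norm _).trans ?_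
  unfold N1
  rw [← integral_const_mul]
  apply integral_mono_of_nonneg (Filter.Eventually.of_forall (fun ω => norm_nonneg _)) ((h.int_norm a).const_mul L)
  refine Filter.Eventually.of_forall (fun ω => ?_)
  simp only [norm_mul, RCLike.norm_conj]
  gcongr
  exact h.bdd i ω

theorem Sys.norm_sq (h : Sys μ φ L) (a : CE n) : ∫ ω, ‖ff φ a ω‖^2 ∂μ = ‖a‖^2 := by
  have e : ∀ ω, ((‖ff φ a ω‖^2 : ℝ) : ℂ) = ∑ i, (starRingEnd ℂ) (a i) * ((starRingEnd ℂ) (φ i ω) * ff φ a ω) := by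
    intro ω
    have : ((‖ff φ a ω‖^2 : ℝ) : ℂ) = (starRingEnd ℂ) (ff φ a ω) * ff φ a ω := by
      rw [Complex.conj_mul']; push_cast; rfl
    rw [this]
    nth_rewrite 1 [ff]
    rw [map_sum, Finset.sum_mul]
    exact Finset.sum_congr rfl (fun i _ => by rw [map_mul]; ring)
  have : ((∫ ω, ‖ff φ a ω‖^2 ∂μ : ℝ) : ℂ) = ((‖a‖^2 : ℝ) : ℂ) := by
    rw [← integral_complex_ofReal]
    simp_rw [e]
    rw [integral_finsetSum]
    · simp_rw [integral_const_mul, h.coeff]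
      rw [EuclideanSpace.norm_sq_eq]
      push_cast
      exact Finset.sum_congr rfl (fun i _ => by rw [Complex.conj_mul'])
    · intro i _
      apply Integrable.const_mul
      refine integrable_of_bdd ?_ (L * ((∑ i, ‖a i‖) * L)) ?_
      · exact (Complex.continuous_conj.measurable.comp (h.meas i)).mul (h.ff_meas a)
      · intro ω
        rw [norm_mul, RCLike.norm_conj]
        have hL := h.one_le
        exact mul_le_mul (h.bdd i ω) (h.ff_bdd a ω) (norm_nonneg _) (by linarith)
  exact_mod_cast this

theorem N1_nonneg (a : CE n) : 0 ≤ N1 μ φ a := integral_nonneg (fun _ => norm_nonneg _)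

theorem Sys.N1_add (h : Sys μ φ L) (a b : CE n) : N1 μ φ (a + b) ≤ N1 μ φ a + N1 μ φ b := by
  unfold N1
  rw [← integral_add (h.int_norm a) (h.int_norm b)]
  apply integral_mono (h.int_norm _) ((h.int_norm a).add (h.int_norm b))
  intro ω
  simp only [ff_add, Pi.add_apply]
  exact norm_add_le _ _

theorem N1_smul (t : ℝ) (a : CE n) : N1 μ φ (t • a) = |t| * N1 μ φ a := by
  unfold N1
  rw [← integral_const_mul]
  congr 1; ext ω
  rw [ff_smul, norm_mul]; simp

/-- the convex body -/
def BB (μ : Measure Ω) (φ : Fin n → Ω → ℂ) (K : ℝ) : Set (CE n) := {a | N1 μ φ a ≤ 1 ∧ ‖a‖ ≤ K}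

theorem zero_mem_BB {K : ℝ} (hK : 0 ≤ K) : (0 : CE n) ∈ BB μ φ K := by
  constructor
  · simp [N1, ff]
  · simpa using hK

theorem Sys.half_mem (h : Sys μ φ L) {K : ℝ} {a b : CE n} (ha : a ∈ BB μ φ K) (hb : b ∈ BB μ φ K) :
    (1/2:ℝ) • (a + b) ∈ BB μ φ K := by
  constructor
  · rw [N1_smul]
    have := h.N1_add a b
    have := ha.1
    have := hb.1
    rw [abs_of_pos (by norm_num)]
    linarith
  · rw [norm_smul]
    have := norm_add_le a b
    have := ha.2
    have := hb.2
    rw [Real.norm_of_nonneg (by norm_num)]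
    linarith

/-- the functional -/
noncomputable def Phi (μ : Measure Ω) (φ : Fin n → Ω → ℂ) (l K : ℝ) (a : CE n) : ℝ :=
  ∫ ω, hh l (ff φ a ω) ∂μ + ‖a‖^2 / K^2

noncomputable def rho (μ : Measure Ω) (φ : Fin n → Ω → ℂ) (l : ℝ) (a b : CE n) : ℝ :=
  ∫ ω, ‖ff φ a ω - ff φ b ω‖^2 / (2 * l + ‖ff φ a ω‖ + ‖ff φ b ω‖) ∂μ

theorem hh_meas (l : ℝ) : Measurable (hh l) := by
  unfold hh FF uu
  fun_prop

theorem Sys.int_hh (h : Sys μ φ L) {l : ℝ} (hl : 0 < l) (a : CE n) : Integrable (fun ω => hh l (ff φ a ω)) μ := by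
  refine Integrable.mono' (g := fun ω => ‖ff φ a ω‖ + ‖ff φ a ω‖ * Real.log (1 + 1) + ‖ff φ a ω‖^2 / (l * 1)) ?_ ?_ ?_
  · exact ((h.int_norm a).add ((h.int_norm a).mul_const _)).add ((h.int_sq a).div_const _)
  · exact ((hh_meas l).comp (h.ff_meas a)).aestronglyMeasurable
  · refine Filter.Eventually.of_forall (fun ω => ?_)
    rw [Real.norm_of_nonneg (hh_nonneg hl _)]
    exact hh_le hl one_pos _

theorem Sys.int_rho (h : Sys μ φ L) {l : ℝ} (hl : 0 < l) (a b : CE n) :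
    Integrable (fun ω => ‖ff φ a ω - ff φ b ω‖^2 / (2 * l + ‖ff φ a ω‖ + ‖ff φ b ω‖)) μ := by
  refine Integrable.mono' (g := fun ω => ‖ff φ (a - b) ω‖^2 / (2 * l)) ((h.int_sq _).div_const _) ?_ ?_
  · have := h.ff_meas a
    have := h.ff_meas b
    exact Measurable.aestronglyMeasurable (by fun_prop)
  · refine Filter.Eventually.of_forall (fun ω => ?_)
    rw [Real.norm_of_nonneg (by positivity), ff_sub]
    apply div_le_div_of_nonneg_left (by positivity) (by positivity)
    have := norm_nonneg (ff φ a ω)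
    have := norm_nonneg (ff φ b ω)
    linarith

theorem Sys.Phi_nonneg {l : ℝ} (hl : 0 < l) (K : ℝ) (a : CE n) : 0 ≤ Phi μ φ l K a := by
  unfold Phi
  have : 0 ≤ ∫ ω, hh l (ff φ a ω) ∂μ := integral_nonneg (fun ω => hh_nonneg hl _)
  positivity

theorem Sys.Phi_le (h : Sys μ φ L) {l K : ℝ} (hl : 0 < l) (hK : 0 < K) {a : CE n} (ha : a ∈ BB μ φ K) :
    Phi μ φ l K a ≤ 3 + Real.log (1 + K^2 / l) := by
  unfold Phi
  set s := K^2 / l with hs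
  have hs0 : 0 < s := by positivity
  have i1 := h.int_norm a
  have i2 : Integrable (fun ω => ‖ff φ a ω‖ * Real.log (1 + s)) μ := i1.mul_const _
  have i3 : Integrable (fun ω => ‖ff φ a ω‖^2 / (l * s)) μ := (h.int_sq a).div_const _
  have h1 : ∫ ω, hh l (ff φ a ω) ∂μ ≤ ∫ ω, (‖ff φ a ω‖ + ‖ff φ a ω‖ * Real.log (1 + s) + ‖ff φ a ω‖^2 / (l * s)) ∂μ :=
    integral_mono (h.int_hh hl a) ((i1.add i2).add i3) (fun ω => hh_le hl hs0 _)
  have i12 : Integrable (fun ω => ‖ff φ a ω‖ + ‖ff φ a ω‖ * Real.log (1 + s)) μ := i1.add i2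
  rw [integral_add i12 i3, integral_add i1 i2, integral_mul_const, integral_div, h.norm_sq] at h1
  have hN : N1 μ φ a ≤ 1 := ha.1
  unfold N1 at hN
  have hlog : 0 ≤ Real.log (1 + s) := Real.log_nonneg (by linarith)
  have e1 : l * s = K^2 := by rw [hs]; field_simp
  have e2 : ‖a‖^2 / K^2 ≤ 1 := by
    rw [div_le_one (by positivity)]
    exact pow_le_pow_left₀ (norm_nonneg _) ha.2 2
  rw [e1] at h1
  nlinarith [mul_le_mul_of_nonneg_right hN hlog]

theorem half_norm_sq {E : Type*} [NormedAddCommGroup E] [InnerProductSpace ℝ E] (a b : E) :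
    ‖(1/2:ℝ) • (a + b)‖^2 = (‖a‖^2 + ‖b‖^2)/2 - ‖a - b‖^2/4 := by
  have := parallelogram_law_with_norm ℝ a b
  rw [norm_smul, mul_pow]
  norm_num
  nlinarith

theorem Sys.Phi_conv (h : Sys μ φ L) {l K : ℝ} (hl : 0 < l) (hK : 0 < K) (a b : CE n) :
    rho μ φ l a b / 6 + ‖a - b‖^2 / (2 * K^2) ≤
      Phi μ φ l K a + Phi μ φ l K b - 2 * Phi μ φ l K ((1/2:ℝ) • (a + b)) := by
  unfold Phi rho
  have e1 := half_norm_sq a b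
  have i1 := h.int_hh hl a
  have i2 := h.int_hh hl b
  have i3 := h.int_hh hl ((1/2:ℝ) • (a + b))
  have key : (∫ ω, ‖ff φ a ω - ff φ b ω‖^2 / (2 * l + ‖ff φ a ω‖ + ‖ff φ b ω‖) ∂μ) / 6
     ≤ ∫ ω, hh l (ff φ a ω) ∂μ + ∫ ω, hh l (ff φ b ω) ∂μ - 2 * ∫ ω, hh l (ff φ ((1/2:ℝ) • (a + b)) ω) ∂μ := by
    have i12 : Integrable (fun ω => hh l (ff φ a ω) + hh l (ff φ b ω)) μ := i1.add i2
    have i33 : Integrable (fun ω => 2 * hh l (ff φ ((1/2:ℝ) • (a + b)) ω)) μ := i3.const_mul 2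
    rw [← integral_add i1 i2, ← integral_const_mul, ← integral_div, ← integral_sub i12 i33]
    apply integral_mono ((h.int_rho hl a b).div_const 6) (i12.sub i33)
    intro ω
    have := hh_conv hl (ff φ a ω) (ff φ b ω)
    have e : ff φ ((1/2:ℝ) • (a + b)) ω = (ff φ a ω + ff φ b ω)/2 := by
      rw [ff_smul, ff_add]; push_cast; ring
    simp only [Pi.sub_apply]
    rw [e, div_div, mul_comm _ (6:ℝ)]
    exact this
  have e2 : ‖a‖^2/K^2 + ‖b‖^2/K^2 - 2 * (‖(1/2:ℝ) • (a + b)‖^2/K^2) = ‖a - b‖^2 / (2 * K^2) := by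
    rw [e1]; field_simp; ring
  linarith
end


theorem packing {W X : Type*} [MeasurableSpace X] (P : Measure X) [IsProbabilityMeasure P]
    (E : W → Set X) (hE : ∀ w, MeasurableSet (E w)) (δ : ℝ) (hδ : 0 < δ) (h : ∀ w, δ ≤ P.real (E w))
    (close : W → W → Prop) (hcl : ∀ w w', (E w ∩ E w').Nonempty → close w w') :
    ∃ M : ℕ, (M : ℝ) ≤ 1 / δ ∧ ∃ c : W → ℕ, (∀ w, c w < M) ∧
      ∀ w w', c w = c w' → ∃ v, close v w ∧ close v w' := by
  classical
  let good : Finset W → Prop := fun F => ∀ a ∈ F, ∀ b ∈ F, a ≠ b → ¬ (E a ∩ E b).Nonempty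
  have hcard : ∀ F, good F → (F.card : ℝ) ≤ 1 / δ := by
    intro F hF
    have hd : Set.PairwiseDisjoint (F : Set W) E := by
      intro a ha b hb hab
      have := hF a ha b hb hab
      rw [Set.not_nonempty_iff_eq_empty] at this
      exact Set.disjoint_iff_inter_eq_empty.2 this
    have h1 : P.real (⋃ w ∈ F, E w) = ∑ w ∈ F, P.real (E w) :=
      measureReal_biUnion_finset hd (fun w _ => hE w)
    have h2 : P.real (⋃ w ∈ F, E w) ≤ 1 := measureReal_le_one
    have h3 : F.card • δ ≤ ∑ w ∈ F, P.real (E w) := Finset.card_nsmul_le_sum _ _ _ (fun w _ => h w)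
    rw [nsmul_eq_mul] at h3
    rw [le_div_iff₀ hδ]
    linarith
  let S : Set ℕ := {k | ∃ F, good F ∧ F.card = k}
  have hSne : S.Nonempty := ⟨0, ∅, by simp [good], by simp⟩
  have hSb : BddAbove S := by
    refine ⟨⌊1/δ⌋₊, ?_⟩
    rintro k ⟨F, hF, rfl⟩
    exact Nat.le_floor (hcard F hF)
  obtain ⟨F, hF, hFc⟩ := Nat.sSup_mem hSne hSb
  have hmax : ∀ w, ∃ v ∈ F, (E v ∩ E w).Nonempty := by
    intro w
    by_contra hcon
    push Not at hcon
    have hwE : (E w).Nonempty := by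
      rw [Set.nonempty_iff_ne_empty]
      intro h0
      have := h w
      rw [h0] at this
      simp at this
      linarith
    have hwF : w ∉ F := by
      intro hw
      have := hcon w hw
      rw [Set.inter_self] at this
      exact hwE.ne_empty this
    have hg : good (insert w F) := by
      intro a ha b hb hab
      rw [Finset.mem_insert] at ha hb
      rcases ha with rfl | ha <;> rcases hb with rfl | hb
      · exact absurd rfl hab
      · rw [Set.inter_comm, hcon b hb]; simp
      · rw [hcon a ha]; simp
      · exact hF a ha b hb hab
    have : (insert w F).card ≤ sSup S := le_csSup hSb ⟨_, hg, rfl⟩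
    rw [Finset.card_insert_of_notMem hwF, hFc] at this
    omega
  choose v hv hvE using hmax
  refine ⟨F.card, hcard F hF, fun w => (F.equivFin ⟨v w, hv w⟩ : ℕ), fun w => (F.equivFin ⟨v w, hv w⟩).2, ?_⟩
  intro w w' hww
  have : v w = v w' := by
    have := F.equivFin.injective (Fin.ext hww)
    simpa using this
  exact ⟨v w, hcl _ _ (hvE w), this ▸ hcl _ _ (hvE w')⟩

section
variable {X : Type*} [MeasurableSpace X]

theorem pi_withDensity_real (P0 : Measure X) [IsProbabilityMeasure P0] (q : X → ℝ) (hqm : Measurable q)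
    (hq0 : ∀ x, 0 ≤ q x) (hqi : Integrable q P0) (N : ℕ) 
    [IsFiniteMeasure (P0.withDensity (fun x => ENNReal.ofReal (q x)))] :
    Measure.pi (fun _ : Fin N => P0.withDensity (fun x => ENNReal.ofReal (q x))) =
      (Measure.pi (fun _ : Fin N => P0)).withDensity (fun ξ => ENNReal.ofReal (∏ l, q (ξ l))) := by
  apply Measure.pi_eq
  intro s hs
  rw [withDensity_apply _ (MeasurableSet.univ_pi hs)]
  have e1 : ∀ l, (P0.withDensity (fun x => ENNReal.ofReal (q x))) (s l) = ENNReal.ofReal (∫ x, (s l).indicator q x ∂P0) := by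
    intro l
    rw [withDensity_apply _ (hs l), integral_indicator (hs l), ofReal_integral_eq_lintegral_ofReal hqi.integrableOn (Filter.Eventually.of_forall hq0)]
  simp_rw [e1]
  rw [← ENNReal.ofReal_prod_of_nonneg (fun l _ => integral_nonneg (fun x => Set.indicator_nonneg (fun x _ => hq0 x) x))]
  rw [← integral_fintype_prod_eq_prod (fun l x => (s l).indicator q x)]
  rw [ofReal_integral_eq_lintegral_ofReal, ← lintegral_indicator (MeasurableSet.univ_pi hs)]
  · congr 1
    ext ξ
    by_cases hξ : ξ ∈ Set.univ.pi s
    · rw [Set.indicator_of_mem hξ]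
      congr 1
      refine Finset.prod_congr rfl (fun l _ => ?_)
      rw [Set.indicator_of_mem (hξ l (Set.mem_univ l))]
    · rw [Set.indicator_of_notMem hξ]
      simp only [Set.mem_pi, Set.mem_univ, true_implies, not_forall] at hξ
      obtain ⟨l, hl⟩ := hξ
      rw [Finset.prod_eq_zero (Finset.mem_univ l) (Set.indicator_of_notMem hl _)]
      simp
  · exact Integrable.fintype_prod_dep (fun l => hqi.indicator (hs l))
  · exact Filter.Eventually.of_forall (fun ξ => Finset.prod_nonneg (fun l _ => Set.indicator_nonneg (fun x _ => hq0 x) _))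

end


section
variable {X : Type*} [MeasurableSpace X]

theorem cheb_second (Q : Measure X) [IsProbabilityMeasure Q] (g : X → ℝ) (hg : Measurable g) (L : ℝ)
    (hL : ∀ x, |g x| ≤ L) (N : ℕ) :
    ∫ ξ : Fin N → X, (∑ l, g (ξ l) - N * ∫ x, g x ∂Q)^2 ∂(Measure.pi fun _ => Q) ≤ N * ∫ x, g x ^ 2 ∂Q := by
  have hmem : MemLp g 2 Q := MemLp.of_bound hg.aestronglyMeasurable L (Filter.Eventually.of_forall hL)
  have hmeml : ∀ l : Fin N, MemLp (fun ξ : Fin N → X => g (ξ l)) 2 (Measure.pi fun _ => Q) := fun l =>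
    MemLp.of_bound (hg.comp (measurable_pi_apply l)).aestronglyMeasurable L (Filter.Eventually.of_forall (fun ξ => hL _))
  have hind := ProbabilityTheory.iIndepFun_pi (X := fun _ : Fin N => g) (μ := fun _ => Q) (fun _ => hg.aemeasurable)
  have hvar := ProbabilityTheory.IndepFun.variance_sum (s := Finset.univ) (fun l _ => hmeml l)
    (fun i _ j _ hij => hind.indepFun hij)
  have hm : ∀ l : Fin N, ∫ ξ : Fin N → X, g (ξ l) ∂(Measure.pi fun _ => Q) = ∫ x, g x ∂Q := fun l =>
    integral_comp_eval (μ := fun _ : Fin N => Q) hg.aestronglyMeasurable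
  have hm2 : ∀ l : Fin N, ProbabilityTheory.variance (fun ξ : Fin N → X => g (ξ l)) (Measure.pi fun _ => Q) ≤ ∫ x, g x ^ 2 ∂Q := by
    intro l
    refine (ProbabilityTheory.variance_le_expectation_sq (hmeml l).1).trans ?_
    have := integral_comp_eval (μ := fun _ : Fin N => Q) (i := l) (f := fun x => g x ^ 2) (hg.pow_const 2).aestronglyMeasurable
    rw [← this]
    rfl
  have hsum : (∑ l, fun ξ : Fin N → X => g (ξ l)) = fun ξ => ∑ l, g (ξ l) := by
    ext ξ; simp
  have hms : Measurable (fun ξ : Fin N → X => ∑ l, g (ξ l)) := by fun_prop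
  rw [hsum, ProbabilityTheory.variance_eq_integral hms.aemeasurable] at hvar
  rw [integral_finsetSum _ (fun l _ => (hmeml l).integrable (by norm_num))] at hvar
  simp only [hm, Finset.sum_const, Finset.card_univ, Fintype.card_fin, nsmul_eq_mul] at hvar
  rw [hvar]
  refine (Finset.sum_le_sum (fun l _ => hm2 l)).trans ?_
  simp

theorem chernoff (Q : Measure X) [IsProbabilityMeasure Q] (g : X → ℝ) (hg : Measurable g) (L V δ : ℝ)
    (hL : ∀ x, |g x| ≤ L) (hV : ∫ x, g x ^ 2 ∂Q ≤ V) (hV0 : 0 < V) (hδ : 0 ≤ δ) (hδL : δ * L ≤ V) (N : ℕ) :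
    (Measure.pi fun _ : Fin N => Q).real {ξ | N * δ ≤ ∑ l, g (ξ l) - N * ∫ x, g x ∂Q} ≤ Real.exp (-(N * δ^2/(4 * V))) := by
  have hgi : Integrable g Q := integrable_of_bdd hg L hL
  set m := ∫ x, g x ∂Q with hm
  have hmL : |m| ≤ L := by
    have := norm_integral_le_of_norm_le_const (μ := Q) (f := g) (C := L) (Filter.Eventually.of_forall hL)
    simpa using this
  set t := δ / (2 * V) with ht
  have ht0 : 0 ≤ t := by positivity
  have htL : t * L ≤ 1/2 := by rw [ht, div_mul_eq_mul_div, div_le_iff₀ (by positivity)]; linarith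
  have habs : ∀ x, |t * (g x - m)| ≤ 1 := by
    intro x
    rw [abs_mul, abs_of_nonneg ht0]
    have := abs_sub (g x) m
    have := hL x
    nlinarith
  have hem : Measurable (fun x => Real.exp (t * (g x - m))) := by fun_prop
  have hei : Integrable (fun x => Real.exp (t * (g x - m))) Q := integrable_of_bdd hem (Real.exp 1) (fun x => by
    rw [Real.norm_of_nonneg (Real.exp_pos _).le]
    exact Real.exp_le_exp.2 ((le_abs_self _).trans (habs x)))
  have hg2 : Integrable (fun x => g x ^ 2) Q := integrable_of_bdd (hg.pow_const 2) (L^2) (fun x => by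
    rw [Real.norm_of_nonneg (sq_nonneg _)]; exact sq_le_sq' (by linarith [(abs_le.1 (hL x)).1]) (abs_le.1 (hL x)).2)
  have hone : ∫ x, Real.exp (t * (g x - m)) ∂Q ≤ Real.exp (t^2 * V) := by
    have hle : ∫ x, Real.exp (t * (g x - m)) ∂Q ≤ ∫ x, ((1 - t * m + t^2 * m^2) + ((t - 2 * t^2 * m) * g x + t^2 * g x ^ 2)) ∂Q := by
      apply integral_mono hei
      · exact (integrable_const _).add ((hgi.const_mul _).add (hg2.const_mul _))
      · intro x
        have := (abs_le.1 (Real.abs_exp_sub_one_sub_id_le (habs x))).2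
        simp only
        nlinarith
    have i2 : Integrable (fun x => (t - 2 * t^2 * m) * g x) Q := hgi.const_mul _
    have i3 : Integrable (fun x => t^2 * g x ^ 2) Q := hg2.const_mul _
    have i4 : Integrable (fun x => (t - 2 * t^2 * m) * g x + t^2 * g x ^ 2) Q := i2.add i3
    rw [integral_add (integrable_const _) i4, integral_add i2 i3, integral_const_mul, integral_const_mul, ← hm] at hle
    simp at hle
    have h2 := Real.add_one_le_exp (t^2 * V)
    nlinarith [sq_nonneg (t * m), mul_le_mul_of_nonneg_left hV (sq_nonneg t)]
  have hprod : ∫ ξ : Fin N → X, ∏ l, Real.exp (t * (g (ξ l) - m)) ∂(Measure.pi fun _ => Q) = (∫ x, Real.exp (t * (g x - m)) ∂Q)^N := by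
    have := integral_fintype_prod_eq_pow (ι := Fin N) (fun x => Real.exp (t * (g x - m))) (μ := Q)
    simpa using this
  have hpi : Integrable (fun ξ : Fin N → X => ∏ l, Real.exp (t * (g (ξ l) - m))) (Measure.pi fun _ => Q) :=
    Integrable.fintype_prod (fun _ => hei)
  have hmk := mul_meas_ge_le_integral_of_nonneg (μ := Measure.pi fun _ : Fin N => Q)
    (Filter.Eventually.of_forall (fun ξ => Finset.prod_nonneg (fun l _ => (Real.exp_pos _).le))) hpi (Real.exp (t * (N * δ)))
  rw [hprod] at hmk
  have hset : {ξ : Fin N → X | Real.exp (t * (N * δ)) ≤ ∏ l, Real.exp (t * (g (ξ l) - m))} ⊇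
      {ξ | N * δ ≤ ∑ l, g (ξ l) - N * m} := by
    intro ξ hξ
    simp only [Set.mem_ofPred_eq] at hξ ⊢
    rw [← Real.exp_sum]
    apply Real.exp_le_exp.2
    rw [← Finset.mul_sum, Finset.sum_sub_distrib]
    simp only [Finset.sum_const, Finset.card_univ, Fintype.card_fin, nsmul_eq_mul]
    exact mul_le_mul_of_nonneg_left hξ ht0
  have h1 := measureReal_mono (μ := Measure.pi fun _ : Fin N => Q) hset
  have h2 : (∫ x, Real.exp (t * (g x - m)) ∂Q)^N ≤ Real.exp (t^2 * V) ^ N :=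
    pow_le_pow_left₀ (integral_nonneg (fun x => (Real.exp_pos _).le)) hone N
  rw [← Real.exp_nat_mul] at h2
  have h3 : Real.exp (t * (N * δ)) * Real.exp (-(N * δ^2/(4 * V))) = Real.exp (N * (t^2 * V)) := by
    rw [← Real.exp_add]; congr 1; rw [ht]; field_simp; ring
  have hp := Real.exp_pos (t * (N * δ))
  rw [← mul_le_mul_iff_right₀ hp]
  calc _ ≤ _ := mul_le_mul_of_nonneg_left h1 hp.le
    _ ≤ _ := hmk
    _ ≤ _ := h2
    _ = _ := h3.symm

/-- two-sided version -/
theorem chernoff_two (Q : Measure X) [IsProbabilityMeasure Q] (g : X → ℝ) (hg : Measurable g) (L V δ : ℝ)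
    (hL : ∀ x, |g x| ≤ L) (hV : ∫ x, g x ^ 2 ∂Q ≤ V) (hV0 : 0 < V) (hδ : 0 ≤ δ) (hδL : δ * L ≤ V) (N : ℕ) :
    (Measure.pi fun _ : Fin N => Q).real {ξ | N * δ ≤ |∑ l, g (ξ l) - N * ∫ x, g x ∂Q|} ≤ 2 * Real.exp (-(N * δ^2/(4 * V))) := by
  have h1 := chernoff Q g hg L V δ hL hV hV0 hδ hδL N
  have h2 := chernoff Q (fun x => - g x) hg.neg L V δ (by simpa using hL) (by simpa using hV) hV0 hδ hδL N
  have hset : {ξ : Fin N → X | N * δ ≤ |∑ l, g (ξ l) - N * ∫ x, g x ∂Q|} ⊆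
     {ξ | N * δ ≤ ∑ l, g (ξ l) - N * ∫ x, g x ∂Q} ∪ {ξ | N * δ ≤ ∑ l, -g (ξ l) - N * ∫ x, -g x ∂Q} := by
    intro ξ hξ
    simp only [Set.mem_ofPred_eq, Set.mem_union, Finset.sum_neg_distrib, integral_neg] at hξ ⊢
    rcases le_abs.1 hξ with h | h
    · left; exact h
    · right; linarith
  have := (measureReal_mono (μ := Measure.pi fun _ : Fin N => Q) hset).trans (measureReal_union_le _ _)
  linarith
end


section
variable {X : Type*} [MeasurableSpace X]

theorem sampling (P0 : Measure X) [IsProbabilityMeasure P0] (q : X → ℝ) (hqm : Measurable q)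
    (hq0 : ∀ x, 0 ≤ q x) (Bq : ℝ) (hqB : ∀ x, q x ≤ Bq) (hq1 : ∫ x, q x ∂P0 = 1)
    {J : Type*} [Fintype J] (n : ℕ) (hn : 16 ≤ n) (hJ : Fintype.card J ≤ 2 * n)
    (g : J → X → ℝ) (hg : ∀ j, Measurable (g j)) (L : ℝ) (hL : ∀ j x, |g j x| ≤ L)
    (hV : ∀ j, ∫ x, q x * g j x ^ 2 ∂P0 ≤ 2) (c : J → ℝ) (hc : ∀ j, 0 ≤ c j) (W : ℝ) (hW0 : 0 < W)
    (hW : ∑ j, c j * ∫ x, q x * g j x ^ 2 ∂P0 ≤ 2 * W) (s : ℝ) (hs : 0 < s) (η : ℝ)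
    (hη : ∫ x, q x ^ (1 + s) ∂P0 ≤ 1 + η) (N : ℕ) (hN0 : 0 < N) (hN : 4 * L^2 * Real.log n ≤ N)
    (M : ℝ) (hM : Real.exp (-(s * M)) * (1 + η)^N ≤ 1/4) :
    Real.exp (-M) / 4 ≤ (Measure.pi fun _ : Fin N => P0).real
      {ξ | ∑ j, c j * ((∑ l, g j (ξ l)) / N - ∫ x, q x * g j x ∂P0)^2 ≤ 8 * W / N ∧
        ∀ j, ((∑ l, g j (ξ l)) / N - ∫ x, q x * g j x ∂P0)^2 ≤ 16 * Real.log n / N} := by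
  have hqi : Integrable q P0 := integrable_of_bdd hqm Bq (fun x => by rw [Real.norm_of_nonneg (hq0 x)]; exact hqB x)
  set Q := P0.withDensity (fun x => ENNReal.ofReal (q x)) with hQ
  have hQp : IsProbabilityMeasure Q := by
    constructor
    rw [hQ, withDensity_apply _ MeasurableSet.univ, Measure.restrict_univ, ← ofReal_integral_eq_lintegral_ofReal hqi (Filter.Eventually.of_forall hq0), hq1]
    simp
  have hQint : ∀ f : X → ℝ, ∫ x, f x ∂Q = ∫ x, q x * f x ∂P0 := by
    intro f
    rw [hQ, integral_withDensity_eq_integral_toReal_smul (by fun_prop) (Filter.Eventually.of_forall (fun x => by simp))]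
    congr 1; ext x
    rw [ENNReal.toReal_ofReal (hq0 x), smul_eq_mul]
  set PP := Measure.pi (fun _ : Fin N => P0) with hPP
  set QQ := Measure.pi (fun _ : Fin N => Q) with hQQ
  have hchange : QQ = PP.withDensity (fun ξ => ENNReal.ofReal (∏ l, q (ξ l))) :=
    pi_withDensity_real P0 q hqm hq0 hqi N
  have hNr : (0:ℝ) < N := by exact_mod_cast hN0
  have hlogn : 1 ≤ Real.log n := by
    rw [Real.le_log_iff_exp_le (by positivity)]
    have := Real.exp_one_lt_d9
    have : (16:ℝ) ≤ n := by exact_mod_cast hn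
    linarith
  set δ := Real.sqrt (16 * Real.log n / N) with hδ
  have hδ2 : δ^2 = 16 * Real.log n / N := Real.sq_sqrt (by positivity)
  have hδ0 : 0 ≤ δ := Real.sqrt_nonneg _
  have hm : ∀ j, ∫ x, g j x ∂Q = ∫ x, q x * g j x ∂P0 := fun j => hQint _
  have hv : ∀ j, ∫ x, g j x ^ 2 ∂Q = ∫ x, q x * g j x ^ 2 ∂P0 := fun j => hQint _
  set G : Set (Fin N → X) := {ξ | ∑ j, c j * ((∑ l, g j (ξ l)) / N - ∫ x, q x * g j x ∂P0)^2 ≤ 8 * W / N ∧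
        ∀ j, ((∑ l, g j (ξ l)) / N - ∫ x, q x * g j x ∂P0)^2 ≤ 16 * Real.log n / N} with hG
  set H : (Fin N → X) → ℝ := fun ξ => ∑ j, c j * ((∑ l, g j (ξ l)) - N * ∫ x, q x * g j x ∂P0)^2 with hH
  set A1 : Set (Fin N → X) := {ξ | 8 * W * N ≤ H ξ} with hA1
  set A2 : J → Set (Fin N → X) := fun j => {ξ | N * δ ≤ |∑ l, g j (ξ l) - N * ∫ x, g j x ∂Q|} with hA2
  set A3 : Set (Fin N → X) := {ξ | Real.exp (s * M) ≤ ∏ l, q (ξ l) ^ s} with hA3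
  -- A1
  have b1 : QQ.real A1 ≤ 1/4 := by
    have hintg : ∀ j, Integrable (fun ξ : Fin N → X => c j * ((∑ l, g j (ξ l)) - N * ∫ x, q x * g j x ∂P0)^2) QQ := by
      intro j
      apply Integrable.const_mul
      have hgj := hg j
      refine integrable_of_bdd (by fun_prop) ((N * L + N * |∫ x, q x * g j x ∂P0|)^2) (fun ξ => ?_)
      rw [Real.norm_of_nonneg (sq_nonneg _), ← sq_abs]
      apply pow_le_pow_left₀ (abs_nonneg _)
      refine (abs_sub _ _).trans ?_
      rw [abs_mul, Nat.abs_cast]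
      gcongr
      refine (Finset.abs_sum_le_sum_abs _ _).trans ((Finset.sum_le_sum (fun l _ => hL j (ξ l))).trans ?_)
      simp
    have e := mul_meas_ge_le_integral_of_nonneg (μ := QQ) (f := H)
      (Filter.Eventually.of_forall (fun ξ => Finset.sum_nonneg (fun j _ => mul_nonneg (hc j) (sq_nonneg _))))
      (integrable_finsetSum _ (fun j _ => hintg j)) (8 * W * N)
    have e2 : ∫ ξ, H ξ ∂QQ ≤ 2 * W * N := by
      rw [hH, integral_finsetSum _ (fun j _ => hintg j)]
      calc _ ≤ ∑ j, c j * (N * ∫ x, q x * g j x ^ 2 ∂P0) := by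
            refine Finset.sum_le_sum (fun j _ => ?_)
            rw [integral_const_mul]
            refine mul_le_mul_of_nonneg_left ?_ (hc j)
            have := cheb_second Q (g j) (hg j) L (hL j) N
            rw [hm, hv] at this
            exact this
        _ = N * ∑ j, c j * ∫ x, q x * g j x ^ 2 ∂P0 := by
            rw [Finset.mul_sum]; exact Finset.sum_congr rfl (fun j _ => by ring)
        _ ≤ N * (2 * W) := by gcongr
        _ = _ := by ring
    have : 8 * W * N * QQ.real A1 ≤ 2 * W * N := e.trans e2
    have hp : 0 < W * N := by positivity
    nlinarith
  have b2 : ∑ j, QQ.real (A2 j) ≤ 1/4 := by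
    have hn16 : (16:ℝ) ≤ n := by exact_mod_cast hn
    have hj : ∀ j, QQ.real (A2 j) ≤ 2 * (1 / (n:ℝ)^2) := by
      intro j
      have hLn : δ * L ≤ 2 := by
        apply le_of_sq_le_sq _ (by norm_num)
        rw [mul_pow, hδ2, div_mul_eq_mul_div, div_le_iff₀ hNr]
        nlinarith
      have := chernoff_two Q (g j) (hg j) L 2 δ (hL j) (by rw [hv]; exact hV j) (by norm_num) hδ0 hLn N
      refine this.trans ?_
      rw [hδ2]
      have e : -(N * (16 * Real.log n / N) / (4 * 2)) = Real.log (1 / (n:ℝ)^2) := by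
        rw [one_div, Real.log_inv, Real.log_pow]; field_simp; norm_num
      rw [e, Real.exp_log (by positivity)]
    calc _ ≤ ∑ j : J, 2 * (1 / (n:ℝ)^2) := Finset.sum_le_sum (fun j _ => hj j)
      _ = Fintype.card J * (2 * (1 / (n:ℝ)^2)) := by simp
      _ ≤ (2 * n : ℕ) * (2 * (1 / (n:ℝ)^2)) := by gcongr
      _ = 4 / n := by push_cast; field_simp; norm_num
      _ ≤ _ := by rw [div_le_div_iff₀ (by positivity) (by norm_num)]; linarith
  have b3 : QQ.real A3 ≤ 1/4 := by
    have hqs : Integrable (fun x => q x ^ s) Q := integrable_of_bdd (hqm.pow_const s) (Bq^s) (fun x => by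
      rw [Real.norm_of_nonneg (Real.rpow_nonneg (hq0 x) _)]
      exact Real.rpow_le_rpow (hq0 x) (hqB x) hs.le)
    have e := mul_meas_ge_le_integral_of_nonneg (μ := QQ) (f := fun ξ => ∏ l, q (ξ l) ^ s)
      (Filter.Eventually.of_forall (fun ξ => Finset.prod_nonneg (fun l _ => Real.rpow_nonneg (hq0 _) _)))
      (Integrable.fintype_prod (f := fun _ x => q x ^ s) (fun _ => hqs)) (Real.exp (s * M))
    have e2 : ∫ ξ, ∏ l, q (ξ l) ^ s ∂QQ = (∫ x, q x ^ (1 + s) ∂P0)^N := by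
      have := integral_fintype_prod_eq_pow (ι := Fin N) (fun x => q x ^ s) (μ := Q)
      simp only [Fintype.card_fin] at this
      rw [hQQ, this, hQint]
      congr 1
      congr 1; ext x
      rcases (hq0 x).eq_or_lt with h0 | h0
      · rw [← h0, zero_mul, Real.zero_rpow (by linarith)]
      · rw [Real.rpow_add h0, Real.rpow_one]
    rw [e2] at e
    have e3 : (∫ x, q x ^ (1 + s) ∂P0)^N ≤ (1 + η)^N :=
      pow_le_pow_left₀ (integral_nonneg (fun x => Real.rpow_nonneg (hq0 x) _)) hη N
    have e4 : QQ.real A3 = Real.exp (-(s * M)) * (Real.exp (s*M) * QQ.real A3) := by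
      rw [← mul_assoc, ← Real.exp_add]; simp
    rw [e4]
    exact (mul_le_mul_of_nonneg_left (e.trans e3) (Real.exp_pos _).le).trans hM
  have hGm : MeasurableSet G := by
    rw [hG]
    have hm1 : Measurable (fun ξ : Fin N → X => ∑ j, c j * ((∑ l, g j (ξ l)) / N - ∫ x, q x * g j x ∂P0)^2) := by fun_prop
    apply MeasurableSet.inter
    · exact measurableSet_le hm1 measurable_const
    · have : {ξ : Fin N → X | ∀ j, ((∑ l, g j (ξ l)) / N - ∫ x, q x * g j x ∂P0)^2 ≤ 16 * Real.log n / N}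
        = ⋂ j, {ξ | ((∑ l, g j (ξ l)) / N - ∫ x, q x * g j x ∂P0)^2 ≤ 16 * Real.log n / N} := by ext; simp
      show MeasurableSet {ξ : Fin N → X | ∀ j, ((∑ l, g j (ξ l)) / N - ∫ x, q x * g j x ∂P0)^2 ≤ 16 * Real.log n / N}
      rw [this]
      exact MeasurableSet.iInter (fun j => measurableSet_le (by have := hg j; fun_prop) measurable_const)
  set R : Set (Fin N → X) := {ξ | ∏ l, q (ξ l) ≤ Real.exp M} with hR
  have hRm : MeasurableSet R := measurableSet_le (by fun_prop) measurable_const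
  have hscale : ∀ (j : J) (ξ : Fin N → X), ((∑ l, g j (ξ l)) / N - ∫ x, q x * g j x ∂P0)^2 = ((∑ l, g j (ξ l)) - N * ∫ x, q x * g j x ∂P0)^2 / N^2 := by
    intro j ξ
    rw [← div_pow]; congr 1; field_simp
  have hcov : (Set.univ : Set (Fin N → X)) ⊆ (G ∩ R) ∪ (A1 ∪ ((⋃ j, A2 j) ∪ A3)) := by
    intro ξ _
    by_contra hcon
    simp only [Set.mem_union, not_or, Set.mem_iUnion, not_exists] at hcon
    obtain ⟨hgr, h1, h2, h3⟩ := hcon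
    apply hgr
    simp only [hA1, hA2, hA3, Set.mem_ofPred_eq, not_le] at h1 h2 h3
    refine ⟨⟨?_, ?_⟩, ?_⟩
    · simp_rw [hscale]
      have : ∑ j, c j * (((∑ l, g j (ξ l)) - N * ∫ x, q x * g j x ∂P0)^2 / N^2) = H ξ / N^2 := by
        rw [hH, Finset.sum_div]; exact Finset.sum_congr rfl (fun j _ => by ring)
      rw [this, div_le_div_iff₀ (by positivity) hNr]
      nlinarith
    · intro j
      have := h2 j
      rw [hm] at this
      rw [hscale, ← hδ2, div_le_iff₀ (by positivity), ← sq_abs, ← mul_pow]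
      apply pow_le_pow_left₀ (abs_nonneg _)
      linarith
    · rw [Real.finsetProd_rpow _ _ (fun l _ => hq0 _), mul_comm s M, Real.exp_mul] at h3
      exact ((Real.rpow_lt_rpow_iff (Finset.prod_nonneg (fun l _ => hq0 _)) (Real.exp_pos _).le hs).1 h3).le
  have hGR : 1/4 ≤ QQ.real (G ∩ R) := by
    have h1 : QQ.real Set.univ = 1 := by simp
    have h2 := measureReal_mono (μ := QQ) hcov
    have h3 := measureReal_union_le (μ := QQ) (G ∩ R) (A1 ∪ ((⋃ j, A2 j) ∪ A3))
    have h4 := measureReal_union_le (μ := QQ) A1 ((⋃ j, A2 j) ∪ A3)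
    have h5 := measureReal_union_le (μ := QQ) (⋃ j, A2 j) A3
    have h6 := measureReal_iUnion_fintype_le (μ := QQ) A2
    linarith
  have hfin : QQ.real (G ∩ R) ≤ Real.exp M * PP.real G := by
    have : QQ (G ∩ R) ≤ ENNReal.ofReal (Real.exp M) * PP G := by
      rw [hchange, withDensity_apply _ (hGm.inter hRm)]
      calc _ ≤ ∫⁻ ξ in G ∩ R, ENNReal.ofReal (Real.exp M) ∂PP := by
            apply setLIntegral_mono (by fun_prop)
            intro ξ hξ
            exact ENNReal.ofReal_le_ofReal hξ.2
        _ = ENNReal.ofReal (Real.exp M) * PP (G ∩ R) := by simp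
        _ ≤ _ := by gcongr; exact Set.inter_subset_left
    rw [measureReal_def, measureReal_def, ← ENNReal.toReal_ofReal (Real.exp_pos M).le, ← ENNReal.toReal_mul]
    exact ENNReal.toReal_mono (ENNReal.mul_ne_top (by simp) (by simp)) this
  have hexp : Real.exp (-M) * Real.exp M = 1 := by rw [← Real.exp_add]; simp
  have hp := Real.exp_pos (-M)
  calc Real.exp (-M) / 4 = Real.exp (-M) * (1/4) := by ring
    _ ≤ Real.exp (-M) * (Real.exp M * PP.real G) := by gcongr; linarith
    _ = PP.real G := by rw [← mul_assoc, hexp, one_mul]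
end


noncomputable def th : Fin 4 → ℂ := ![1, Complex.I, -1, -Complex.I]

/-- real part of `conj (th t) * z` -/
noncomputable def rt (t : Fin 4) (z : ℂ) : ℝ := (![z.re, z.im, -z.re, -z.im] : Fin 4 → ℝ) t

/-- density -/
noncomputable def qd (c : ℝ) (t : Fin 4) (z : ℂ) : ℝ :=
  1 - c + if ‖z‖ ≤ 1/4 then 2 * rt t z else 4 * max (rt t z) 0

noncomputable def cpx (b : Bool) (z : ℂ) : ℝ := if b then z.im else z.re

/-- the high part -/
noncomputable def hip (z : ℂ) : ℝ := if ‖z‖ ≤ 1/4 then 0 else |z.re| + |z.im|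

noncomputable def mnz (z : ℂ) : ℝ := min (‖z‖^2) ‖z‖

theorem rt_abs (t : Fin 4) (z : ℂ) : |rt t z| ≤ ‖z‖ := by
  have h1 := Complex.abs_re_le_norm z
  have h2 := Complex.abs_im_le_norm z
  fin_cases t <;> simp [rt] <;> assumption

theorem rt_meas (t : Fin 4) : Measurable (rt t) := by
  have h1 : Measurable (fun z : ℂ => z.re) := Complex.measurable_re
  have h2 : Measurable (fun z : ℂ => z.im) := Complex.measurable_im
  fin_cases t
  · exact h1
  · exact h2
  · exact h1.neg
  · exact h2.neg

theorem qd_meas (c : ℝ) (t : Fin 4) : Measurable (qd c t) := by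
  have := rt_meas t
  unfold qd
  refine measurable_const.add (Measurable.ite ?_ (by fun_prop) (by fun_prop))
  exact measurableSet_le measurable_norm measurable_const

theorem qd_nonneg {c : ℝ} (hc : c ≤ 1/2) (t : Fin 4) (z : ℂ) : 0 ≤ qd c t z := by
  unfold qd
  split_ifs with h
  · have := (abs_le.1 (rt_abs t z)).1
    linarith
  · have := le_max_right (rt t z) 0
    linarith

theorem qd_le {c : ℝ} (hc : 0 ≤ c) (t : Fin 4) (z : ℂ) : qd c t z ≤ 1 + 4 * ‖z‖ := by
  unfold qd
  have := (abs_le.1 (rt_abs t z)).2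
  have := norm_nonneg z
  split_ifs with h
  · linarith
  · have : max (rt t z) 0 ≤ ‖z‖ := max_le (by assumption) (by assumption)
    linarith

theorem max_add_max_neg (x : ℝ) : max x 0 + max (-x) 0 = |x| := by
  rcases le_total 0 x with h | h
  · rw [max_eq_left h, max_eq_right (by linarith), abs_of_nonneg h, add_zero]
  · rw [max_eq_right h, max_eq_left (by linarith), abs_of_nonpos h, zero_add]

theorem max_sub_max_neg (x : ℝ) : max x 0 - max (-x) 0 = x := by
  rcases le_total 0 x with h | h
  · rw [max_eq_left h, max_eq_right (by linarith), sub_zero]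
  · rw [max_eq_right h, max_eq_left (by linarith)]; ring

theorem qd_avg (c : ℝ) (z : ℂ) : (1/4) * ∑ t, qd c t z = 1 - c + hip z := by
  have h1 := max_add_max_neg z.re
  have h2 := max_add_max_neg z.im
  rw [Fin.sum_univ_four]
  simp only [qd, hip]
  split_ifs with h
  · simp [rt]; ring
  · simp [rt]; linear_combination h1 + h2

theorem qd_mean (c : ℝ) (z w : ℂ) (b : Bool) :
    (1/4) * ∑ t, qd c t z * cpx b (th t * (starRingEnd ℂ) w) = cpx b ((starRingEnd ℂ) w * z) := by
  have h1 := max_sub_max_neg z.re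
  have h2 := max_sub_max_neg z.im
  rw [Fin.sum_univ_four]
  simp only [qd]
  split_ifs with h
  · cases b <;> simp [rt, cpx, th] <;> ring
  · cases b
    · simp [rt, cpx, th]
      linear_combination w.re * h1 + w.im * h2
    · simp [rt, cpx, th]
      linear_combination (-w.im) * h1 + w.re * h2

theorem cpx_sq_add (z : ℂ) : cpx false z ^ 2 + cpx true z ^ 2 = ‖z‖^2 := by
  simp [cpx, Complex.sq_norm, Complex.normSq_apply]; ring

theorem cpx_abs (b : Bool) (z : ℂ) : |cpx b z| ≤ ‖z‖ := by
  cases b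
  · exact Complex.abs_re_le_norm z
  · exact Complex.abs_im_le_norm z

theorem cpx_meas (b : Bool) : Measurable (cpx b) := by
  cases b
  · exact Complex.measurable_re
  · exact Complex.measurable_im

theorem th_norm (t : Fin 4) : ‖th t‖ = 1 := by
  fin_cases t <;> simp [th]

theorem mnz_nonneg (z : ℂ) : 0 ≤ mnz z := le_min (by positivity) (norm_nonneg _)

theorem hip_le (z : ℂ) : hip z ≤ 8 * mnz z := by
  unfold hip
  split_ifs with h
  · have := mnz_nonneg z; linarith
  · push Not at h
    have h1 := Complex.abs_re_le_norm z
    have h2 := Complex.abs_im_le_norm z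
    have : ‖z‖ / 4 ≤ mnz z := le_min (by nlinarith) (by linarith)
    linarith

theorem hip_nonneg (z : ℂ) : 0 ≤ hip z := by
  unfold hip; split_ifs <;> positivity

theorem hip_meas : Measurable hip := by
  unfold hip
  refine Measurable.ite ?_ measurable_const ?_
  · exact measurableSet_le measurable_norm measurable_const
  · have h1 : Measurable (fun z : ℂ => z.re) := Complex.measurable_re
    have h2 : Measurable (fun z : ℂ => z.im) := Complex.measurable_im
    exact h1.abs.add h2.abs

theorem mnz_meas : Measurable mnz := by unfold mnz; fun_prop

theorem rpow_low {x s : ℝ} (hx : -1 ≤ x) (hs0 : 0 ≤ s) (hs1 : s ≤ 1) :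
    (1 + x) ^ (1 + s) ≤ 1 + (1 + s) * x + s * x^2 := by
  rcases hx.eq_or_lt with h | h
  · rw [← h]
    have : (1:ℝ) + -1 = 0 := by norm_num
    rw [this, Real.zero_rpow (by linarith)]; linarith
  · rw [Real.rpow_add (by linarith), Real.rpow_one]
    have := rpow_one_add_le_one_add_mul_self hx hs0 hs1
    nlinarith [mul_le_mul_of_nonneg_left this (show 0 ≤ 1 + x by linarith)]

theorem rpow_high {q S s : ℝ} (hq : 0 ≤ q) (hS : Real.exp 1 ≤ S) (hs : s = 1 / Real.log S) :
    q ^ (1 + s) ≤ Real.exp 1 * (q + q^2 / S) := by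
  have hS0 : 0 < S := (Real.exp_pos 1).trans_le hS
  have hlog : 1 ≤ Real.log S := (Real.le_log_iff_exp_le hS0).2 hS
  have hs0 : 0 < s := by rw [hs]; positivity
  have hs1 : s ≤ 1 := by rw [hs, div_le_one (by linarith)]; exact hlog
  have hSs : S ^ s = Real.exp 1 := by
    rw [Real.rpow_def_of_pos hS0, hs, mul_one_div_cancel (by linarith)]
  rcases hq.eq_or_lt with h | h
  · rw [← h, Real.zero_rpow (by linarith)]; simp
  rw [Real.rpow_add h, Real.rpow_one]
  have key : q ^ s ≤ Real.exp 1 * (1 + q / S) := by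
    have e : q ^ s = S^s * (q/S)^s := by
      rw [← Real.mul_rpow hS0.le (by positivity)]; congr 1; field_simp
    rw [e, hSs]
    gcongr
    rcases le_total (q/S) 1 with h1 | h1
    · have := Real.rpow_le_one (show 0 ≤ q / S by positivity) h1 hs0.le
      have : 0 ≤ q / S := by positivity
      linarith
    · have := Real.rpow_le_rpow_of_exponent_le h1 hs1
      rw [Real.rpow_one] at this
      linarith
  calc q * q^s ≤ q * (Real.exp 1 * (1 + q / S)) := by gcongr
    _ = _ := by field_simp

theorem qd_entropy {c S s : ℝ} (hc0 : 0 ≤ c) (hc : c ≤ 1/2) (hS : Real.exp 1 ≤ S) (hs : s = 1 / Real.log S) (z : ℂ) :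
    (1/4) * ∑ t, qd c t z ^ (1 + s) ≤ 1 + 90 * mnz z + 175 * ‖z‖^2 / S := by
  have hS0 : 0 < S := (Real.exp_pos 1).trans_le hS
  have hlog : 1 ≤ Real.log S := (Real.le_log_iff_exp_le hS0).2 hS
  have hs0 : 0 < s := by rw [hs]; positivity
  have hs1 : s ≤ 1 := by rw [hs, div_le_one (by linarith)]; exact hlog
  have hq2 : 0 ≤ 175 * ‖z‖^2 / S := by positivity
  by_cases h : ‖z‖ ≤ 1/4
  · have hmn : mnz z = ‖z‖^2 := by
      unfold mnz; apply min_eq_left; nlinarith [norm_nonneg z]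
    have hz2 : ‖z‖^2 = z.re^2 + z.im^2 := by rw [Complex.sq_norm, Complex.normSq_apply]; ring
    have hb : ∀ t, qd c t z ^ (1 + s) ≤ 1 + (1 + s) * (-c + 2 * rt t z) + s * (-c + 2 * rt t z)^2 := by
      intro t
      have e : qd c t z = 1 + (-c + 2 * rt t z) := by simp only [qd, if_pos h]; ring
      rw [e]
      apply rpow_low _ hs0.le hs1
      have := (abs_le.1 (rt_abs t z)).1
      linarith
    have hsum : (1/4) * ∑ t, qd c t z ^ (1 + s) ≤ 1 - (1 + s) * c + s * (c^2 + 2 * ‖z‖^2) := by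
      calc _ ≤ (1/4) * ∑ t, (1 + (1 + s) * (-c + 2 * rt t z) + s * (-c + 2 * rt t z)^2) := by
            gcongr with t _; exact hb t
        _ = _ := by
            rw [hz2, Fin.sum_univ_four]; simp [rt]; ring
    have : s * (c^2 + 2 * ‖z‖^2) ≤ c^2 + 2 * ‖z‖^2 := by nlinarith [sq_nonneg c, sq_nonneg ‖z‖]
    rw [hmn]
    nlinarith [sq_nonneg ‖z‖]
  · push Not at h
    have hz : ‖z‖ ≤ 4 * mnz z := by
      have : ‖z‖ / 4 ≤ mnz z := le_min (by nlinarith) (by linarith)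
      linarith
    have hb : ∀ t, qd c t z ^ (1 + s) ≤ 22 * ‖z‖ + 175 * ‖z‖^2 / S := by
      intro t
      have h0 := qd_nonneg hc t z
      have h1 := qd_le hc0 t z
      have h2 : qd c t z ≤ 8 * ‖z‖ := by linarith
      refine (rpow_high h0 hS hs).trans ?_
      have h3 : qd c t z + qd c t z ^ 2 / S ≤ 8 * ‖z‖ + (8 * ‖z‖)^2 / S := by gcongr
      have he := Real.exp_one_lt_d9
      have h4 : 0 ≤ ‖z‖^2 / S := by positivity
      have e5 : (8 * ‖z‖)^2 / S = 64 * (‖z‖^2 / S) := by ring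
      have e6 : 175 * ‖z‖^2 / S = 175 * (‖z‖^2 / S) := by ring
      rw [e6]
      rw [e5] at h3
      calc _ ≤ Real.exp 1 * (8 * ‖z‖ + 64 * (‖z‖^2 / S)) := by gcongr
        _ ≤ 2.7182818286 * (8 * ‖z‖ + 64 * (‖z‖^2 / S)) := by gcongr
        _ ≤ _ := by nlinarith [norm_nonneg z]
    calc _ ≤ (1/4) * ∑ t : Fin 4, (22 * ‖z‖ + 175 * ‖z‖^2 / S) := by gcongr with t _; exact hb t
      _ = 22 * ‖z‖ + 175 * ‖z‖^2 / S := by simp; ring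
      _ ≤ _ := by nlinarith

/-- uniform measure on `Fin 4` -/
noncomputable def nu4 : Measure (Fin 4) := (4⁻¹ : ENNReal) • Measure.count

instance : IsProbabilityMeasure nu4 := by
  constructor
  simp only [nu4, Measure.smul_apply, smul_eq_mul]
  rw [Measure.count_apply_finite _ Set.finite_univ]
  simp
  exact ENNReal.inv_mul_cancel (by norm_num) (by norm_num)

theorem integral_nu4 (f : Fin 4 → ℝ) : ∫ t, f t ∂nu4 = (1/4) * ∑ t, f t := by
  unfold nu4
  rw [integral_smul_measure, integral_count]
  simp

theorem integral_X {Ω : Type*} [MeasurableSpace Ω] (μ : Measure Ω) [IsProbabilityMeasure μ] (F : Ω → Fin 4 → ℝ)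
    (hF : ∀ t, Measurable (fun ω => F ω t)) (B : ℝ) (hB : ∀ ω t, |F ω t| ≤ B) :
    ∫ p : Ω × Fin 4, F p.1 p.2 ∂(μ.prod nu4) = ∫ ω, (1/4) * ∑ t, F ω t ∂μ := by
  have hm : Measurable (fun p : Ω × Fin 4 => F p.1 p.2) := measurable_from_prod_countable_left (fun t => hF t)
  rw [integral_prod]
  · simp_rw [integral_nu4]
  · exact integrable_of_bdd hm B (fun p => hB p.1 p.2)


section
variable {Ω : Type*} [MeasurableSpace Ω] {μ : Measure Ω} [IsProbabilityMeasure μ] {n : ℕ}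
  {φ : Fin n → Ω → ℂ} {L : ℝ}

/-- test functions -/
noncomputable def gX (φ : Fin n → Ω → ℂ) (j : Fin n × Bool) (p : Ω × Fin 4) : ℝ :=
  cpx j.2 (th p.2 * (starRingEnd ℂ) (φ j.1 p.1))

theorem Sys.gX_meas (h : Sys μ φ L) (j : Fin n × Bool) : Measurable (gX φ j) := by
  unfold gX
  refine measurable_from_prod_countable_left (fun t => ?_)
  exact (cpx_meas j.2).comp ((Complex.continuous_conj.measurable.comp (h.meas j.1)).const_mul _)

theorem Sys.gX_abs (h : Sys μ φ L) (j : Fin n × Bool) (p : Ω × Fin 4) : |gX φ j p| ≤ L := by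
  unfold gX
  refine (cpx_abs _ _).trans ?_
  rw [norm_mul, th_norm, one_mul, RCLike.norm_conj]
  exact h.bdd _ _

theorem cpx_integral (f : Ω → ℂ) (hf : Integrable f μ) (b : Bool) : ∫ ω, cpx b (f ω) ∂μ = cpx b (∫ ω, f ω ∂μ) := by
  cases b
  · exact integral_re hf
  · exact integral_im hf

theorem Sys.cover_event (h : Sys μ φ L) (hn : 16 ≤ n) {l K S m : ℝ} (hl : 96 * L^2 ≤ l) (hK : 0 < K)
    (hS : Real.exp 1 ≤ S) (hm : Real.log n ≤ m) (z : Ω → ℂ) (hz : Measurable z) (Bz : ℝ) (hBz : ∀ ω, ‖z ω‖ ≤ Bz)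
    (hz1 : ∫ ω, mnz (z ω) ∂μ ≤ 6 / l) (hz2 : ∫ ω, ‖z ω‖^2 ∂μ ≤ S / l)
    (x : CE n) (hx : ‖x‖ ≤ K) (N : ℕ) (hN1 : m * l ≤ N) (hN2 : (N:ℝ) ≤ 2 * (m * l)) :
    Real.exp (-(1442 * m * Real.log S)) / 4 ≤ (Measure.pi fun _ : Fin N => μ.prod nu4).real
      {ξ | ∑ j : Fin n × Bool, ‖x j.1‖^2 * ((∑ k, gX φ j (ξ k)) / N -
              cpx j.2 (∫ ω, (starRingEnd ℂ) (φ j.1 ω) * z ω ∂μ))^2 ≤ 8 * K^2 / N ∧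
        ∀ j : Fin n × Bool, ((∑ k, gX φ j (ξ k)) / N - cpx j.2 (∫ ω, (starRingEnd ℂ) (φ j.1 ω) * z ω ∂μ))^2
          ≤ 16 * Real.log n / N} := by
  have hL := h.one_le
  have hl0 : 0 < l := by nlinarith
  have hlogn : 1 ≤ Real.log n := by
    rw [Real.le_log_iff_exp_le (by positivity)]
    have := Real.exp_one_lt_d9
    have : (16:ℝ) ≤ n := by exact_mod_cast hn
    linarith
  have hS0 : 0 < S := (Real.exp_pos 1).trans_le hS
  have hlogS : 1 ≤ Real.log S := (Real.le_log_iff_exp_le hS0).2 hS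
  have hBz0 : ∀ ω : Ω, 0 ≤ Bz := fun ω => (norm_nonneg _).trans (hBz ω)
  have hmni : Integrable (fun ω => mnz (z ω)) μ := integrable_of_bdd (mnz_meas.comp hz) Bz (fun ω => by
    rw [Real.norm_of_nonneg (mnz_nonneg _)]; exact (min_le_right _ _).trans (hBz ω))
  have hhii : Integrable (fun ω => hip (z ω)) μ := by
    refine Integrable.mono' (hmni.const_mul 8) (hip_meas.comp hz).aestronglyMeasurable (Filter.Eventually.of_forall (fun ω => ?_))
    rw [Real.norm_of_nonneg (hip_nonneg _)]; exact hip_le _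
  set c := ∫ ω, hip (z ω) ∂μ with hc
  have hc0 : 0 ≤ c := integral_nonneg (fun ω => hip_nonneg _)
  have hcL : c * L^2 ≤ 1/2 := by
    have h1 : c ≤ 8 * (6 / l) := by
      calc c ≤ ∫ ω, 8 * mnz (z ω) ∂μ := integral_mono hhii (hmni.const_mul 8) (fun ω => hip_le _)
        _ = 8 * ∫ ω, mnz (z ω) ∂μ := integral_const_mul _ _
        _ ≤ _ := by gcongr
    have h2 : 8 * (6 / l) * L^2 ≤ 1/2 := by
      rw [mul_div_assoc', div_mul_eq_mul_div, div_le_iff₀ hl0]; linarith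
    exact (mul_le_mul_of_nonneg_right h1 (sq_nonneg L)).trans h2
  have hL2 : 1 ≤ L^2 := by nlinarith
  have hc2 : c ≤ 1/2 := by nlinarith [mul_le_mul_of_nonneg_left hL2 hc0]
  set q : Ω × Fin 4 → ℝ := fun p => qd c p.2 (z p.1) with hq
  have hqt : ∀ t, Measurable (fun ω => qd c t (z ω)) := fun t => (qd_meas c t).comp hz
  have hqm : Measurable q := measurable_from_prod_countable_left hqt
  have hq0 : ∀ p, 0 ≤ q p := fun p => qd_nonneg hc2 _ _
  have hqB : ∀ p, q p ≤ 1 + 4 * Bz := fun p => (qd_le hc0 _ _).trans (by have := hBz p.1; linarith)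
  have hqBabs : ∀ ω t, |qd c t (z ω)| ≤ 1 + 4 * Bz := fun ω t => by
    rw [abs_of_nonneg (qd_nonneg hc2 _ _)]; exact hqB (ω, t)
  have hq1 : ∫ p, q p ∂(μ.prod nu4) = 1 := by
    have := integral_X μ (fun ω t => qd c t (z ω)) hqt _ hqBabs
    rw [hq, this]
    simp_rw [qd_avg]
    rw [integral_add (integrable_const _) hhii, ← hc]
    simp
  have hgt : ∀ (j : Fin n × Bool) t, Measurable (fun ω => gX φ j (ω, t)) := fun j t =>
    (h.gX_meas j).comp (measurable_id.prodMk measurable_const)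
  have hmean : ∀ j : Fin n × Bool, ∫ p, q p * gX φ j p ∂(μ.prod nu4) =
      cpx j.2 (∫ ω, (starRingEnd ℂ) (φ j.1 ω) * z ω ∂μ) := by
    intro j
    have := integral_X μ (fun ω t => qd c t (z ω) * gX φ j (ω, t)) (fun t => (hqt t).mul (hgt j t)) ((1 + 4 * Bz) * L)
      (fun ω t => by
        rw [abs_mul]; exact mul_le_mul (hqBabs ω t) (h.gX_abs j _) (abs_nonneg _) (by have := hBz0 ω; positivity))
    rw [hq, this]
    unfold gX
    simp_rw [qd_mean]
    apply cpx_integral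
    refine integrable_of_bdd ((Complex.continuous_conj.measurable.comp (h.meas j.1)).mul hz) (L * Bz) (fun ω => ?_)
    rw [norm_mul, RCLike.norm_conj]
    exact mul_le_mul (h.bdd _ _) (hBz ω) (norm_nonneg _) (by linarith)
  have hsqint : ∀ j : Fin n × Bool, Integrable (fun p => q p * gX φ j p ^ 2) (μ.prod nu4) := by
    intro j
    refine integrable_of_bdd (hqm.mul ((h.gX_meas j).pow_const 2)) ((1 + 4 * Bz) * L^2) (fun p => ?_)
    rw [Real.norm_of_nonneg (mul_nonneg (hq0 p) (sq_nonneg _)), ← sq_abs]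
    have := h.gX_abs j p
    have := hqB p
    have := hBz0 p.1
    gcongr
  have hV2 : ∀ i : Fin n, ∫ p, q p * gX φ (i, false) p ^ 2 ∂(μ.prod nu4) + ∫ p, q p * gX φ (i, true) p ^ 2 ∂(μ.prod nu4) ≤ 2 := by
    intro i
    rw [← integral_add (hsqint _) (hsqint _)]
    have e : ∀ p : Ω × Fin 4, q p * gX φ (i, false) p ^ 2 + q p * gX φ (i, true) p ^ 2 = qd c p.2 (z p.1) * ‖φ i p.1‖^2 := by
      intro p
      rw [← mul_add]
      unfold gX
      rw [cpx_sq_add, norm_mul, th_norm, one_mul, RCLike.norm_conj]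
    simp_rw [e]
    have hφ := (h.meas i).norm
    rw [integral_X μ (fun ω t => qd c t (z ω) * ‖φ i ω‖^2) (fun t => (hqt t).mul (hφ.pow_const 2)) ((1 + 4 * Bz) * L^2)
      (fun ω t => by
        rw [abs_mul]
        refine mul_le_mul (hqBabs ω t) ?_ (abs_nonneg _) (by have := hBz0 ω; positivity)
        rw [abs_of_nonneg (sq_nonneg _)]
        have := h.bdd i ω
        gcongr)]
    have hφ2i : Integrable (fun ω => ‖φ i ω‖^2) μ := integrable_of_bdd (hφ.pow_const 2) (L^2) (fun ω => by
      rw [Real.norm_of_nonneg (sq_nonneg _)]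
      have := h.bdd i ω
      gcongr)
    have hφ2 : ∫ ω, ‖φ i ω‖^2 ∂μ = 1 := by
      have := h.norm_sq (EuclideanSpace.single i (1:ℂ))
      have e : ∀ ω, ff φ (EuclideanSpace.single i (1:ℂ)) ω = φ i ω := by
        intro ω; simp [ff]
      simp_rw [e] at this
      rw [this]; simp
    calc _ ≤ ∫ ω, (‖φ i ω‖^2 + L^2 * hip (z ω)) ∂μ := by
          apply integral_mono_of_nonneg
          · exact Filter.Eventually.of_forall (fun ω => mul_nonneg (by norm_num)
              (Finset.sum_nonneg (fun t _ => mul_nonneg (qd_nonneg hc2 _ _) (sq_nonneg _))))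
          · exact hφ2i.add (hhii.const_mul _)
          · refine Filter.Eventually.of_forall (fun ω => ?_)
            simp only
            rw [← Finset.sum_mul, ← mul_assoc, qd_avg]
            have h1 : ‖φ i ω‖^2 ≤ L^2 := by have := h.bdd i ω; gcongr
            nlinarith [mul_le_mul_of_nonneg_left h1 (hip_nonneg (z ω)), sq_nonneg ‖φ i ω‖]
      _ = 1 + L^2 * c := by rw [integral_add hφ2i (hhii.const_mul _), hφ2, integral_const_mul]
      _ ≤ 2 := by linarith
  have hVnn : ∀ j : Fin n × Bool, 0 ≤ ∫ p, q p * gX φ j p ^ 2 ∂(μ.prod nu4) := fun j =>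
    integral_nonneg (fun p => mul_nonneg (hq0 p) (sq_nonneg _))
  have hV : ∀ j : Fin n × Bool, ∫ p, q p * gX φ j p ^ 2 ∂(μ.prod nu4) ≤ 2 := by
    rintro ⟨i, b⟩
    have h1 := hVnn (i, false)
    have h2 := hVnn (i, true)
    have := hV2 i
    cases b <;> linarith
  have hW : ∑ j : Fin n × Bool, ‖x j.1‖^2 * ∫ p, q p * gX φ j p ^ 2 ∂(μ.prod nu4) ≤ 2 * K^2 := by
    rw [Fintype.sum_prod_type]
    have e : ∀ i, ∑ b : Bool, ‖x i‖^2 * ∫ p, q p * gX φ (i, b) p ^ 2 ∂(μ.prod nu4) ≤ 2 * ‖x i‖^2 := by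
      intro i
      rw [Fintype.sum_bool, ← mul_add]
      nlinarith [hV2 i, sq_nonneg ‖x i‖]
    refine (Finset.sum_le_sum (fun i _ => e i)).trans ?_
    rw [← Finset.mul_sum, ← EuclideanSpace.norm_sq_eq]
    have := norm_nonneg x
    gcongr
  set s := 1 / Real.log S with hs
  have hs0 : 0 < s := by positivity
  have hη : ∫ p, q p ^ (1 + s) ∂(μ.prod nu4) ≤ 1 + 720 / l := by
    rw [integral_X μ (fun ω t => qd c t (z ω) ^ (1 + s)) (fun t => (hqt t).pow_const _) ((1 + 4 * Bz)^(1+s)) (fun ω t => by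
      rw [abs_of_nonneg (Real.rpow_nonneg (qd_nonneg hc2 _ _) _)]
      exact Real.rpow_le_rpow (qd_nonneg hc2 _ _) (hqB (ω, t)) (by positivity))]
    have hzi : Integrable (fun ω => ‖z ω‖^2) μ := integrable_of_bdd (hz.norm.pow_const 2) (Bz^2) (fun ω => by
      rw [Real.norm_of_nonneg (sq_nonneg _)]
      have := hBz ω
      gcongr)
    have i1 : Integrable (fun ω => 1 + 90 * mnz (z ω)) μ := (integrable_const _).add (hmni.const_mul _)
    have i2 : Integrable (fun ω => 175 * ‖z ω‖^2 / S) μ := (hzi.const_mul _).div_const _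
    calc _ ≤ ∫ ω, (1 + 90 * mnz (z ω) + 175 * ‖z ω‖^2 / S) ∂μ := by
          apply integral_mono_of_nonneg
          · exact Filter.Eventually.of_forall (fun ω => mul_nonneg (by norm_num)
              (Finset.sum_nonneg (fun t _ => Real.rpow_nonneg (qd_nonneg hc2 _ _) _)))
          · exact i1.add i2
          · exact Filter.Eventually.of_forall (fun ω => qd_entropy hc0 hc2 hS hs (z ω))
      _ = 1 + 90 * ∫ ω, mnz (z ω) ∂μ + 175 * (∫ ω, ‖z ω‖^2 ∂μ) / S := by
          rw [integral_add i1 i2, integral_add (integrable_const _) (hmni.const_mul _), integral_const_mul, integral_div, integral_const_mul]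
          simp
      _ ≤ 1 + 90 * (6 / l) + 175 * (S / l) / S := by gcongr
      _ = 1 + 715 / l := by field_simp; ring
      _ ≤ _ := by gcongr; norm_num
  have hmpos : 1 ≤ m := hlogn.trans hm
  have hN0 : 0 < N := by
    have : (0:ℝ) < N := lt_of_lt_of_le (by positivity) hN1
    exact_mod_cast this
  have hNL : 4 * L^2 * Real.log n ≤ N := by
    refine le_trans ?_ hN1
    have : 4 * L^2 ≤ l := by nlinarith
    calc _ ≤ l * m := by gcongr
      _ = _ := mul_comm _ _
  have hM : Real.exp (-(s * (1442 * m * Real.log S))) * (1 + 720 / l)^N ≤ 1/4 := by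
    have e1 : s * (1442 * m * Real.log S) = 1442 * m := by rw [hs]; field_simp
    have e2 : (1 + 720/l)^N ≤ Real.exp (1440 * m) := by
      calc (1 + 720/l)^N ≤ (Real.exp (720 / l))^N := by
            gcongr; have := Real.add_one_le_exp (720/l); linarith
        _ = Real.exp (N * (720 / l)) := by rw [Real.exp_nat_mul]
        _ ≤ _ := by
            apply Real.exp_le_exp.2
            calc (N:ℝ) * (720/l) ≤ 2 * (m * l) * (720/l) := by gcongr
              _ = _ := by field_simp; ring
    rw [e1]
    have e3 : Real.exp (-2) ≤ 1/4 := by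
      have := Real.exp_one_gt_d9
      have h3 : Real.exp (-2) = (Real.exp 1 ^ 2)⁻¹ := by
        rw [← Real.exp_nat_mul, ← Real.exp_neg]; norm_num
      rw [h3, one_div]
      gcongr
      nlinarith
    calc _ ≤ Real.exp (-(1442 * m)) * Real.exp (1440 * m) := by gcongr
      _ = Real.exp (-(2 * m)) := by rw [← Real.exp_add]; congr 1; ring
      _ ≤ Real.exp (-2) := Real.exp_le_exp.2 (by linarith)
      _ ≤ _ := e3
  have hfinal := sampling (μ.prod nu4) q hqm hq0 _ hqB hq1 (J := Fin n × Bool) n hn (by simp; omega) (gX φ) h.gX_meas L h.gX_abs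
    hV (fun j => ‖x j.1‖^2) (fun j => sq_nonneg _) (K^2) (by positivity) hW s hs0 (720 / l) hη N hN0 hNL
    (1442 * m * Real.log S) hM
  simp_rw [hmean] at hfinal
  exact hfinal
end


section
variable {Ω : Type*} [MeasurableSpace Ω] {μ : Measure Ω} [IsProbabilityMeasure μ] {n : ℕ}
  {φ : Fin n → Ω → ℂ} {L : ℝ}

theorem min_aux {l r D F G : ℝ} (hl : 0 < l) (hr : 0 < r) (hD : 0 ≤ D) (hF : 0 ≤ F) (hG : 0 ≤ G) :
    min ((1 / (r * l) * D)^2) (1 / (r * l) * D) ≤ (1 / l) * (4 / r^2 * (D^2 / (2 * l + F + G)) + (F + G)) := by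
  set v := 2 * l + F + G with hv
  have hv0 : 0 < v := by positivity
  set d := D / r with hd
  have hd0 : 0 ≤ d := by positivity
  have e1 : 1 / (r * l) * D = 1 / l * d := by rw [hd]; field_simp
  have e2 : 4 / r^2 * (D^2 / v) = 4 * d^2 / v := by rw [hd]; field_simp
  rw [e1, e2]
  by_cases hc : v ≤ 4 * l
  · refine (min_le_left _ _).trans ?_
    have : 1 / l * d^2 ≤ 4 * d^2 / v := by
      rw [one_div, inv_mul_eq_div, div_le_div_iff₀ hl hv0]
      nlinarith [mul_le_mul_of_nonneg_left hc (sq_nonneg d)]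
    calc (1 / l * d)^2 = 1 / l * (1 / l * d^2) := by ring
      _ ≤ 1 / l * (4 * d^2 / v + (F + G)) := by
        gcongr; linarith
  · refine (min_le_right _ _).trans ?_
    push Not at hc
    have : d ≤ d^2 / v + v / 4 := by
      have : d^2 / v + v / 4 - d = (d - v/2)^2 / v := by field_simp; ring
      have : 0 ≤ (d - v/2)^2 / v := by positivity
      linarith
    have h4 : d^2 / v ≤ 4 * d^2 / v := by gcongr; nlinarith [sq_nonneg d]
    gcongr
    linarith

theorem Sys.cover (h : Sys μ φ L) (hn : 16 ≤ n) {l K r m : ℝ} (hl : l = 96 * L^2) (hK : 0 < K) (hr : 0 < r)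
    (hS : Real.exp 1 ≤ K^2 / l) (hm : Real.log n ≤ m) {x : CE n} (hx : x ∈ BB μ φ K) {W : Type*} (w : W → CE n)
    (hw : ∀ f, w f ∈ BB μ φ K) (h1 : ∀ f, rho μ φ l (w f) x ≤ r^2) (h2 : ∀ f, ‖w f - x‖ ≤ K * r) :
    ∃ M : ℕ, (M:ℝ) ≤ Real.exp (1444 * m * Real.log (K^2 / l)) ∧ ∃ c : W → ℕ, (∀ f, c f < M) ∧
      ∀ f g, c f = c g → ∑ i, ‖x i‖^2 * ‖w f i - w g i‖^2 ≤ 128 * r^2 * l * K^2 / m ∧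
        ∀ i, ‖w f i - w g i‖^2 ≤ 512 * r^2 * l * Real.log n / m := by
  have hL := h.one_le
  have hl0 : 0 < l := by rw [hl]; positivity
  have hlogn : 1 ≤ Real.log n := by
    rw [Real.le_log_iff_exp_le (by positivity)]
    have := Real.exp_one_lt_d9
    have : (16:ℝ) ≤ n := by exact_mod_cast hn
    linarith
  have hm1 : 1 ≤ m := hlogn.trans hm
  set S := K^2 / l with hSd
  have hS0 : 0 < S := (Real.exp_pos 1).trans_le hS
  have hlogS : 1 ≤ Real.log S := (Real.le_log_iff_exp_le hS0).2 hS
  set N := ⌈m * l⌉₊ with hN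
  have hN1 : m * l ≤ N := Nat.le_ceil _
  have hml : 1 ≤ m * l := by nlinarith
  have hN2 : (N:ℝ) ≤ 2 * (m * l) := by
    have := (Nat.ceil_lt_add_one (by positivity : 0 ≤ m * l)).le
    linarith
  have hN0 : (0:ℝ) < N := by linarith
  -- the test function
  set z : W → Ω → ℂ := fun f => ff φ ((1 / (r * l)) • (w f - x)) with hz
  have hzn : ∀ f ω, ‖z f ω‖ = 1 / (r * l) * ‖ff φ (w f) ω - ff φ x ω‖ := by
    intro f ω
    rw [hz]; simp only
    rw [ff_smul, ff_sub, norm_mul, Complex.norm_real, Real.norm_of_nonneg (by positivity)]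
  have hz1 : ∀ f, ∫ ω, mnz (z f ω) ∂μ ≤ 6 / l := by
    intro f
    have i1 := h.int_rho hl0 (w f) x
    have i2 := h.int_norm (w f)
    have i3 := h.int_norm x
    have hb := (hw f).1
    have hb2 := hx.1
    unfold N1 at hb hb2
    have hrr := h1 f
    unfold rho at hrr
    calc ∫ ω, mnz (z f ω) ∂μ ≤ ∫ ω, (1 / l) * (4 / r^2 * (‖ff φ (w f) ω - ff φ x ω‖^2 / (2 * l + ‖ff φ (w f) ω‖ + ‖ff φ x ω‖))
          + (‖ff φ (w f) ω‖ + ‖ff φ x ω‖)) ∂μ := by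
          apply integral_mono_of_nonneg
          · exact Filter.Eventually.of_forall (fun ω => mnz_nonneg _)
          · exact ((i1.const_mul _).add (i2.add i3)).const_mul _
          · refine Filter.Eventually.of_forall (fun ω => ?_)
            simp only [mnz, hzn]
            exact min_aux hl0 hr (norm_nonneg _) (norm_nonneg _) (norm_nonneg _)
      _ = (1 / l) * (4 / r^2 * rho μ φ l (w f) x + (N1 μ φ (w f) + N1 μ φ x)) := by
          unfold rho N1
          have i23 : Integrable (fun ω => ‖ff φ (w f) ω‖ + ‖ff φ x ω‖) μ := i2.add i3
          rw [integral_const_mul, integral_add (i1.const_mul _) i23, integral_const_mul, integral_add i2 i3]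
      _ ≤ (1 / l) * (4 / r^2 * r^2 + (1 + 1)) := by
          have := h1 f
          have := (hw f).1
          have := hx.1
          gcongr
      _ = 6 / l := by field_simp; ring
  have hz2 : ∀ f, ∫ ω, ‖z f ω‖^2 ∂μ ≤ S / l := by
    intro f
    rw [hz]; simp only
    rw [h.norm_sq, norm_smul, Real.norm_of_nonneg (by positivity), mul_pow]
    calc _ ≤ (1 / (r * l))^2 * (K * r)^2 := by have := h2 f; gcongr
      _ = _ := by rw [hSd]; field_simp
  have hev := fun f => h.cover_event hn hl.ge hK hS hm (z f) (h.ff_meas _) _ (h.ff_bdd _) (hz1 f) (hz2 f) x hx.2 N hN1 hN2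
  have hcoef : ∀ f i, ∫ ω, (starRingEnd ℂ) (φ i ω) * z f ω ∂μ = ((1 / (r * l) : ℝ) : ℂ) * (w f i - x i) := by
    intro f i
    rw [hz]; simp only
    rw [h.coeff]; simp
  simp_rw [hcoef] at hev
  set E : W → Set (Fin N → Ω × Fin 4) := fun f => {ξ | ∑ j : Fin n × Bool, ‖x j.1‖^2 * ((∑ k, gX φ j (ξ k)) / N -
              cpx j.2 (((1 / (r * l) : ℝ) : ℂ) * (w f j.1 - x j.1)))^2 ≤ 8 * K^2 / N ∧
        ∀ j : Fin n × Bool, ((∑ k, gX φ j (ξ k)) / N - cpx j.2 (((1 / (r * l) : ℝ) : ℂ) * (w f j.1 - x j.1)))^2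
          ≤ 16 * Real.log n / N} with hE
  have hEm : ∀ f, MeasurableSet (E f) := by
    intro f
    have hg := h.gX_meas
    have m1 : ∀ j : Fin n × Bool, Measurable (fun ξ : Fin N → Ω × Fin 4 => ((∑ k, gX φ j (ξ k)) / N -
        cpx j.2 (((1 / (r * l) : ℝ) : ℂ) * (w f j.1 - x j.1)))^2) := fun j => by have := hg j; fun_prop
    have m2 : Measurable (fun ξ : Fin N → Ω × Fin 4 => ∑ j : Fin n × Bool, ‖x j.1‖^2 * ((∑ k, gX φ j (ξ k)) / N -
        cpx j.2 (((1 / (r * l) : ℝ) : ℂ) * (w f j.1 - x j.1)))^2) :=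
      Finset.measurable_sum _ (fun j _ => (m1 j).const_mul _)
    have e : E f = {ξ | ∑ j : Fin n × Bool, ‖x j.1‖^2 * ((∑ k, gX φ j (ξ k)) / N -
              cpx j.2 (((1 / (r * l) : ℝ) : ℂ) * (w f j.1 - x j.1)))^2 ≤ 8 * K^2 / N} ∩
        ⋂ j : Fin n × Bool, {ξ | ((∑ k, gX φ j (ξ k)) / N - cpx j.2 (((1 / (r * l) : ℝ) : ℂ) * (w f j.1 - x j.1)))^2
          ≤ 16 * Real.log n / N} := by
      ext ξ; simp [hE]
    rw [e]
    exact (measurableSet_le m2 measurable_const).inter (MeasurableSet.iInter (fun j => measurableSet_le (m1 j) measurable_const))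
  have hcpx : ∀ b (f g : W) (i : Fin n), cpx b (((1 / (r * l) : ℝ) : ℂ) * (w f i - x i)) - cpx b (((1 / (r * l) : ℝ) : ℂ) * (w g i - x i))
      = cpx b (((1 / (r * l) : ℝ) : ℂ) * (w f i - w g i)) := by
    intro b f g i
    cases b <;> simp [cpx] <;> ring
  have hnsq : ∀ (f g : W) (i : Fin n), ‖w f i - w g i‖^2 = (r * l)^2 * (cpx false (((1 / (r * l) : ℝ) : ℂ) * (w f i - w g i))^2
      + cpx true (((1 / (r * l) : ℝ) : ℂ) * (w f i - w g i))^2) := by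
    intro f g i
    rw [cpx_sq_add, norm_mul, Complex.norm_real, Real.norm_of_nonneg (by positivity)]
    field_simp
  obtain ⟨M, hM, c, hc, hcc⟩ := packing (Measure.pi fun _ : Fin N => μ.prod nu4) E hEm _ (by positivity) hev
    (fun f g => ∑ i, ‖x i‖^2 * ‖w f i - w g i‖^2 ≤ 32 * r^2 * l * K^2 / m ∧
        ∀ i, ‖w f i - w g i‖^2 ≤ 128 * r^2 * l * Real.log n / m) (by
    rintro f g ⟨ξ, hf, hg⟩
    have key : ∀ j : Fin n × Bool, cpx j.2 (((1 / (r * l) : ℝ) : ℂ) * (w f j.1 - w g j.1))^2 ≤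
        2 * ((∑ k, gX φ j (ξ k)) / N - cpx j.2 (((1 / (r * l) : ℝ) : ℂ) * (w f j.1 - x j.1)))^2
        + 2 * ((∑ k, gX φ j (ξ k)) / N - cpx j.2 (((1 / (r * l) : ℝ) : ℂ) * (w g j.1 - x j.1)))^2 := by
      intro j
      rw [← hcpx]
      nlinarith [sq_nonneg (((∑ k, gX φ j (ξ k)) / N - cpx j.2 (((1 / (r * l) : ℝ) : ℂ) * (w f j.1 - x j.1))) +
        ((∑ k, gX φ j (ξ k)) / N - cpx j.2 (((1 / (r * l) : ℝ) : ℂ) * (w g j.1 - x j.1))))]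
    constructor
    · have e : ∑ i, ‖x i‖^2 * ‖w f i - w g i‖^2 = (r * l)^2 * ∑ j : Fin n × Bool, ‖x j.1‖^2 * cpx j.2 (((1 / (r * l) : ℝ) : ℂ) * (w f j.1 - w g j.1))^2 := by
        rw [Fintype.sum_prod_type, Finset.mul_sum]
        refine Finset.sum_congr rfl (fun i _ => ?_)
        rw [Fintype.sum_bool, hnsq]; ring
      rw [e]
      have e2 : ∑ j : Fin n × Bool, ‖x j.1‖^2 * cpx j.2 (((1 / (r * l) : ℝ) : ℂ) * (w f j.1 - w g j.1))^2 ≤ 32 * K^2 / N := by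
        calc _ ≤ ∑ j : Fin n × Bool, (2 * (‖x j.1‖^2 * ((∑ k, gX φ j (ξ k)) / N - cpx j.2 (((1 / (r * l) : ℝ) : ℂ) * (w f j.1 - x j.1)))^2)
              + 2 * (‖x j.1‖^2 * ((∑ k, gX φ j (ξ k)) / N - cpx j.2 (((1 / (r * l) : ℝ) : ℂ) * (w g j.1 - x j.1)))^2)) := by
              refine Finset.sum_le_sum (fun j _ => ?_)
              refine (mul_le_mul_of_nonneg_left (key j) (sq_nonneg _)).trans_eq ?_
              ring
          _ ≤ 2 * (8 * K^2 / N) + 2 * (8 * K^2 / N) := by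
              rw [Finset.sum_add_distrib, ← Finset.mul_sum, ← Finset.mul_sum]
              exact add_le_add (mul_le_mul_of_nonneg_left hf.1 (by norm_num)) (mul_le_mul_of_nonneg_left hg.1 (by norm_num))
          _ = _ := by ring
      calc _ ≤ (r * l)^2 * (32 * K^2 / N) := by gcongr
        _ ≤ (r * l)^2 * (32 * K^2 / (m * l)) := by gcongr
        _ = _ := by field_simp
    · intro i
      rw [hnsq]
      have k1 := key (i, false)
      have k2 := key (i, true)
      have a1 := hf.2 (i, false)
      have a2 := hf.2 (i, true)
      have a3 := hg.2 (i, false)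
      have a4 := hg.2 (i, true)
      simp only at k1 k2 a1 a2 a3 a4
      calc _ ≤ (r * l)^2 * (8 * (16 * Real.log n / N)) := by
            gcongr; linarith
        _ ≤ (r * l)^2 * (8 * (16 * Real.log n / (m * l))) := by gcongr
        _ = _ := by field_simp; ring)
  refine ⟨M, hM.trans ?_, c, hc, ?_⟩
  · have e3 : (4:ℝ) ≤ Real.exp 2 := by
      have := Real.exp_one_gt_d9
      have h3 : Real.exp 2 = (Real.exp 1 ^ 2) := by
        rw [← Real.exp_nat_mul]; norm_num
      rw [h3]
      nlinarith
    calc 1 / (Real.exp (-(1442 * m * Real.log S)) / 4) = 4 * Real.exp (1442 * m * Real.log S) := by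
          rw [Real.exp_neg]; field_simp
      _ ≤ Real.exp 2 * Real.exp (1442 * m * Real.log S) := by gcongr
      _ = Real.exp (2 + 1442 * m * Real.log S) := by rw [Real.exp_add]
      _ ≤ _ := by apply Real.exp_le_exp.2; nlinarith
  · intro f g hfg
    obtain ⟨v, ⟨a1, a2⟩, b1, b2⟩ := hcc f g hfg
    have key : ∀ i, ‖w f i - w g i‖^2 ≤ 2 * ‖w v i - w f i‖^2 + 2 * ‖w v i - w g i‖^2 := by
      intro i
      have e : ‖w f i - w g i‖ ≤ ‖w v i - w f i‖ + ‖w v i - w g i‖ := by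
        have := norm_sub_le (w v i - w g i) (w v i - w f i)
        rw [show w v i - w g i - (w v i - w f i) = w f i - w g i by ring] at this
        linarith
      have e0 := norm_nonneg (w f i - w g i)
      nlinarith [sq_nonneg (‖w v i - w f i‖ - ‖w v i - w g i‖)]
    constructor
    · calc _ ≤ ∑ i, (2 * (‖x i‖^2 * ‖w v i - w f i‖^2) + 2 * (‖x i‖^2 * ‖w v i - w g i‖^2)) := by
            refine Finset.sum_le_sum (fun j _ => ?_)
            refine (mul_le_mul_of_nonneg_left (key j) (sq_nonneg _)).trans_eq ?_
            ring
        _ ≤ 2 * (32 * r^2 * l * K^2 / m) + 2 * (32 * r^2 * l * K^2 / m) := by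
            rw [Finset.sum_add_distrib, ← Finset.mul_sum, ← Finset.mul_sum]
            exact add_le_add (mul_le_mul_of_nonneg_left a1 (by norm_num)) (mul_le_mul_of_nonneg_left b1 (by norm_num))
        _ = _ := by ring
    · intro i
      have := key i
      have e1 := a2 i
      have e2 := b2 i
      calc _ ≤ 2 * (128 * r^2 * l * Real.log n / m) + 2 * (128 * r^2 * l * Real.log n / m) := by linarith
        _ = _ := by ring
end


section
variable {n : ℕ}

noncomputable def yy (a : CE n) : RE n := WithLp.toLp 2 (fun i => ‖a i‖^2)

noncomputable def dd (a b : CE n) : ℝ := ‖yy a - yy b‖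
noncomputable def QQ (a : CE n) : ℝ := ‖yy a‖
noncomputable def ss (f g : CE n) : ℝ := dd f g + QQ (f - g)

theorem yy_apply (a : CE n) (i : Fin n) : yy a i = ‖a i‖^2 := rfl

theorem QQ_nonneg (a : CE n) : 0 ≤ QQ a := norm_nonneg _
theorem dd_nonneg (a b : CE n) : 0 ≤ dd a b := norm_nonneg _
theorem ss_nonneg (a b : CE n) : 0 ≤ ss a b := add_nonneg (dd_nonneg _ _) (QQ_nonneg _)

theorem yy_zero : yy (0 : CE n) = 0 := by ext i; simp [yy_apply]
theorem yy_neg (a : CE n) : yy (-a) = yy a := by ext i; simp [yy_apply]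

theorem QQ_neg (a : CE n) : QQ (-a) = QQ a := by rw [QQ, yy_neg, QQ]
theorem QQ_sub_comm (a b : CE n) : QQ (a - b) = QQ (b - a) := by rw [← QQ_neg, neg_sub]
theorem dd_comm (a b : CE n) : dd a b = dd b a := norm_sub_rev _ _
theorem ss_comm (a b : CE n) : ss a b = ss b a := by rw [ss, ss, dd_comm, QQ_sub_comm]
theorem ss_self (a : CE n) : ss a a = 0 := by simp [ss, dd, QQ, yy_zero]
theorem dd_triangle (a b c : CE n) : dd a c ≤ dd a b + dd b c := by
  unfold dd
  have := norm_add_le (yy a - yy b) (yy b - yy c)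
  simpa using this

theorem re_norm_mono {u v : RE n} (h : ∀ i, |u i| ≤ v i) : ‖u‖ ≤ ‖v‖ := by
  rw [EuclideanSpace.norm_eq, EuclideanSpace.norm_eq]
  apply Real.sqrt_le_sqrt
  apply Finset.sum_le_sum
  intro i _
  have h1 : ‖u i‖ ≤ ‖v i‖ := by rw [Real.norm_eq_abs]; exact (h i).trans (le_abs_self _)
  gcongr

theorem yy_half (p q : CE n) : yy ((1/2:ℝ) • (p + q)) = (1/2:ℝ) • (yy p + yy q) - (1/4:ℝ) • yy (p - q) := by
  ext i
  have := half_norm_sq (p i) (q i)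
  simp only [yy_apply, PiLp.smul_apply, PiLp.add_apply, PiLp.sub_apply, smul_eq_mul] at this ⊢
  rw [this]; ring

theorem dd_half (f p q : CE n) : dd f ((1/2:ℝ) • (p + q)) ≤ 1/2 * dd f p + 1/2 * dd f q + 1/4 * QQ (p - q) := by
  unfold dd QQ
  rw [yy_half]
  have e : yy f - ((1/2:ℝ) • (yy p + yy q) - (1/4:ℝ) • yy (p - q)) =
      (1/2:ℝ) • (yy f - yy p) + (1/2:ℝ) • (yy f - yy q) + (1/4:ℝ) • yy (p - q) := by module
  rw [e]
  refine (norm_add₃_le).trans ?_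
  simp only [norm_smul]
  norm_num

theorem QQ_half (p q : CE n) : QQ ((1/2:ℝ) • (p + q)) ≤ 1/2 * QQ p + 1/2 * QQ q + 1/4 * QQ (p - q) := by
  have := dd_half 0 p q
  simpa [dd, QQ, yy_zero] using this

theorem ss_half (f p q : CE n) : ss f ((1/2:ℝ) • (p + q)) ≤ 1/2 * ss f p + 1/2 * ss f q + 1/2 * QQ (p - q) := by
  unfold ss
  have h1 := dd_half f p q
  have h2 := QQ_half (f - p) (f - q)
  have e1 : (1/2:ℝ) • (f - p + (f - q)) = f - (1/2:ℝ) • (p + q) := by module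
  have e2 : f - p - (f - q) = q - p := by abel
  rw [e1, e2, QQ_sub_comm q p] at h2
  linarith

theorem QQ_add (p q : CE n) : QQ (p + q) ≤ 2 * QQ p + 2 * QQ q := by
  have h : QQ (p + q) ≤ ‖(2:ℝ) • yy p + (2:ℝ) • yy q‖ := by
    apply re_norm_mono
    intro i
    have h1 := norm_add_le (p i) (q i)
    have h0 := norm_nonneg (p i + q i)
    simp only [yy_apply, PiLp.add_apply, PiLp.smul_apply, smul_eq_mul]
    rw [abs_of_nonneg (by positivity)]
    nlinarith [sq_nonneg (‖p i‖ - ‖q i‖)]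
  refine h.trans ((norm_add_le _ _).trans ?_)
  simp [norm_smul, QQ]

theorem QQ_tri (a b c : CE n) : QQ (a - c) ≤ 2 * QQ (a - b) + 2 * QQ (b - c) := by
  have := QQ_add (a - b) (b - c)
  simpa using this

theorem ce_abs_norm (p : CE n) : ‖(WithLp.toLp 2 (fun i => ‖p i‖) : RE n)‖ = ‖p‖ := by
  rw [EuclideanSpace.norm_eq, EuclideanSpace.norm_eq]; simp

theorem QQ_le {A : ℝ} (p : CE n) (hA0 : 0 ≤ A) (hA : ∀ i, ‖p i‖ ≤ A) : QQ p ≤ A * ‖p‖ := by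
  have h : QQ p ≤ ‖A • (WithLp.toLp 2 (fun i => ‖p i‖) : RE n)‖ := by
    apply re_norm_mono
    intro i
    simp only [yy_apply, PiLp.smul_apply, smul_eq_mul]
    rw [abs_of_nonneg (by positivity)]
    nlinarith [hA i, norm_nonneg (p i)]
  rw [norm_smul, ce_abs_norm, Real.norm_of_nonneg hA0] at h
  exact h

theorem dd_le {A : ℝ} (w w' x : CE n) (hA0 : 0 ≤ A) (hA : ∀ i, ‖w i - w' i‖ ≤ A) :
    dd w w' ≤ 2 * Real.sqrt (∑ i, ‖x i‖^2 * ‖w i - w' i‖^2) + A * (‖w - x‖ + ‖w' - x‖) := by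
  have h : dd w w' ≤ ‖(2:ℝ) • (WithLp.toLp 2 (fun i => ‖x i‖ * ‖w i - w' i‖) : RE n) +
      (A • (WithLp.toLp 2 (fun i => ‖(w - x) i‖) : RE n) + A • (WithLp.toLp 2 (fun i => ‖(w' - x) i‖) : RE n))‖ := by
    apply re_norm_mono
    intro i
    simp only [yy_apply, PiLp.smul_apply, PiLp.add_apply, PiLp.sub_apply, smul_eq_mul]
    have e : ‖w i‖^2 - ‖w' i‖^2 = (‖w i‖ - ‖w' i‖) * (‖w i‖ + ‖w' i‖) := by ring
    rw [e, abs_mul, abs_of_nonneg (by positivity : 0 ≤ ‖w i‖ + ‖w' i‖)]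
    have h1 := abs_norm_sub_norm_le (w i) (w' i)
    have h2 : ‖w i‖ ≤ ‖x i‖ + ‖w i - x i‖ := by
      have := norm_add_le (x i) (w i - x i)
      simpa using this
    have h3 : ‖w' i‖ ≤ ‖x i‖ + ‖w' i - x i‖ := by
      have := norm_add_le (x i) (w' i - x i)
      simpa using this
    have h4 := hA i
    have h5 := norm_nonneg (w i - w' i)
    calc _ ≤ ‖w i - w' i‖ * ((‖x i‖ + ‖w i - x i‖) + (‖x i‖ + ‖w' i - x i‖)) := by gcongr
      _ = 2 * (‖x i‖ * ‖w i - w' i‖) + (‖w i - w' i‖ * ‖w i - x i‖ + ‖w i - w' i‖ * ‖w' i - x i‖) := by ring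
      _ ≤ _ := by gcongr
  refine h.trans ((norm_add_le _ _).trans ?_)
  refine (add_le_add le_rfl (norm_add_le _ _)).trans ?_
  rw [norm_smul, norm_smul, norm_smul, ce_abs_norm, ce_abs_norm, Real.norm_of_nonneg hA0, mul_add]
  have e : ‖(WithLp.toLp 2 (fun i => ‖x i‖ * ‖w i - w' i‖) : RE n)‖ = Real.sqrt (∑ i, ‖x i‖^2 * ‖w i - w' i‖^2) := by
    rw [EuclideanSpace.norm_eq]; simp [mul_pow]
  rw [e]; norm_num

end

section
variable {Ω : Type*} [MeasurableSpace Ω] {μ : Measure Ω} [IsProbabilityMeasure μ] {n : ℕ}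
  {φ : Fin n → Ω → ℂ} {L : ℝ}

theorem Sys.QQ_BB (h : Sys μ φ L) {K : ℝ} {f : CE n} (hf : f ∈ BB μ φ K) : QQ f ≤ L * K := by
  have hL := h.one_le
  refine (QQ_le f (by linarith) (fun i => ?_)).trans (mul_le_mul_of_nonneg_left hf.2 (by linarith))
  have := h.coeff_le f i
  have := hf.1
  nlinarith

theorem Sys.dd_BB (h : Sys μ φ L) {K : ℝ} {f g : CE n} (hf : f ∈ BB μ φ K) (hg : g ∈ BB μ φ K) : dd f g ≤ 2 * (L * K) := by
  have h1 := h.QQ_BB hf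
  have h2 := h.QQ_BB hg
  have := norm_sub_le (yy f) (yy g)
  unfold QQ at h1 h2
  unfold dd
  linarith

theorem Sys.QQ_sub_BB (h : Sys μ φ L) {K : ℝ} {f g : CE n} (hf : f ∈ BB μ φ K) (hg : g ∈ BB μ φ K) : QQ (f - g) ≤ 4 * (L * K) := by
  have h1 := h.QQ_BB hf
  have h2 := h.QQ_BB hg
  have := QQ_add f (-g)
  rw [QQ_neg, ← sub_eq_add_neg] at this
  linarith

/-- `w` is an approximate minimiser for `f` -/
def NearMin (μ : Measure Ω) (φ : Fin n → Ω → ℂ) (l K t e : ℝ) (f w : CE n) : Prop :=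
  w ∈ BB μ φ K ∧ ∀ g ∈ BB μ φ K, Phi μ φ l K w + t * ss f w ≤ Phi μ φ l K g + t * ss f g + e

theorem exists_nearMin {l K t e : ℝ} (hl : 0 < l) (hK : 0 < K) (ht : 0 ≤ t) (he : 0 < e) (f : CE n) :
    ∃ w, NearMin μ φ l K t e f w := by
  set G : CE n → ℝ := fun g => Phi μ φ l K g + t * ss f g with hG
  have hG0 : ∀ g, 0 ≤ G g := fun g => add_nonneg (Sys.Phi_nonneg hl K g) (mul_nonneg ht (ss_nonneg _ _))
  have hne : (G '' BB μ φ K).Nonempty := ⟨G 0, 0, zero_mem_BB hK.le, rfl⟩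
  have hbd : BddBelow (G '' BB μ φ K) := ⟨0, by rintro _ ⟨g, _, rfl⟩; exact hG0 g⟩
  obtain ⟨_, ⟨w, hw, rfl⟩, hlt⟩ := exists_lt_of_csInf_lt hne (lt_add_of_pos_right (sInf (G '' BB μ φ K)) he)
  refine ⟨w, hw, fun g hg => ?_⟩
  have := csInf_le hbd ⟨g, hg, rfl⟩
  simp only [hG] at this hlt ⊢
  linarith

theorem Sys.near_close (h : Sys μ φ L) {l K t e D s : ℝ} (hl : 0 < l) (hK : 0 < K) (ht : 0 ≤ t) {f f' w w' : CE n}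
    (hw : NearMin μ φ l K t e f w) (hw' : NearMin μ φ l K t e f' w') (hd : dd f f' ≤ D) (hQ : QQ (f - f') ≤ D)
    (hs : ss f w ≤ s) (hs' : ss f' w' ≤ s) :
    rho μ φ l w w' ≤ 54 * t * (D + s) + 12 * e ∧ ‖w - w'‖^2 ≤ K^2 * (54 * t * (D + s) + 12 * e) := by
  set u := (1/2:ℝ) • (w + w') with hu
  have hu' : u ∈ BB μ φ K := h.half_mem hw.1 hw'.1
  have c1 := hw.2 u hu'
  have c2 := hw'.2 u hu'
  have c3 := h.Phi_conv hl hK w w'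
  have a1 := ss_half f w w'
  have a2 := ss_half f' w w'
  rw [← hu] at a1 a2 c3
  have nd := dd_nonneg f w
  have nq := QQ_nonneg (f - w)
  have nd' := dd_nonneg f' w'
  have nq' := QQ_nonneg (f' - w')
  have b1 : ss f w' ≤ 3 * D + 2 * s := by
    have := dd_triangle f f' w'
    have := QQ_tri f f' w'
    unfold ss at *
    linarith
  have b2 : ss f' w ≤ 3 * D + 2 * s := by
    have := dd_triangle f' f w
    have := QQ_tri f' f w
    rw [dd_comm f' f] at *
    rw [QQ_sub_comm f' f] at *
    unfold ss at *
    linarith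
  have b3 : QQ (w - w') ≤ 4 * D + 6 * s := by
    have h1 := QQ_tri w f w'
    have h2 := QQ_tri f f' w'
    rw [QQ_sub_comm w f] at h1
    unfold ss at hs hs'
    linarith
  have D0 : 0 ≤ D := (dd_nonneg _ _).trans hd
  have s0 : 0 ≤ s := (ss_nonneg _ _).trans hs
  have b4 : ss f u - ss f w + (ss f' u - ss f' w') ≤ 9 * (D + s) := by
    have := ss_nonneg f w
    have := ss_nonneg f' w'
    linarith
  have b5 := mul_le_mul_of_nonneg_left b4 ht
  have b6 : rho μ φ l w w' / 6 + ‖w - w'‖^2 / (2 * K^2) ≤ t * (9 * (D + s)) + 2 * e := by nlinarith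
  have r0 : 0 ≤ rho μ φ l w w' := integral_nonneg (fun ω => by positivity)
  have n0 : 0 ≤ ‖w - w'‖^2 / (2 * K^2) := by positivity
  constructor
  · linarith
  · have : ‖w - w'‖^2 / (2 * K^2) ≤ t * (9 * (D + s)) + 2 * e := by linarith
    rw [div_le_iff₀ (by positivity)] at this
    have hx : 0 ≤ t * (9 * (D + s)) + 2 * e := n0.trans (by linarith)
    nlinarith [mul_nonneg (sq_nonneg K) hx]

theorem Sys.sum_s (h : Sys μ φ L) {l K e t0 : ℝ} (hl : 0 < l) (hK : 0 < K) (ht0 : 0 ≤ t0) {f : CE n} (hf : f ∈ BB μ φ K)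
    (w : ℕ → CE n) (hw : ∀ k, NearMin μ φ l K (t0 * 2^k) e f (w k)) (N : ℕ) :
    ∑ k ∈ Finset.range N, t0 * 2^k * ss f (w k) ≤ 2 * (3 + Real.log (1 + K^2 / l)) + 2 * N * e := by
  have hG : ∀ k, Phi μ φ l K (w k) + t0 * 2^k * ss f (w k) ≤ 3 + Real.log (1 + K^2/l) + e := by
    intro k
    have := (hw k).2 f hf
    rw [ss_self] at this
    have := h.Phi_le hl hK hf
    linarith
  have hG0 : ∀ k, 0 ≤ Phi μ φ l K (w k) := fun k => Sys.Phi_nonneg hl K _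
  cases N with
  | zero =>
    have h1 := hG 0
    have h2 := h.Phi_le hl hK hf
    have h3 := Sys.Phi_nonneg (μ := μ) (φ := φ) hl K f
    simp; linarith
  | succ N =>
    have key : ∀ N : ℕ, ∑ k ∈ Finset.range (N+1), t0 * 2^k * ss f (w k) ≤ 2 * (Phi μ φ l K (w N) + t0 * 2^N * ss f (w N)) + 2 * N * e := by
      intro N
      induction N with
      | zero =>
        have := hG0 0
        have := mul_nonneg ht0 (ss_nonneg f (w 0))
        simp; linarith
      | succ N ih =>
        rw [Finset.sum_range_succ]
        have := (hw N).2 (w (N+1)) (hw (N+1)).1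
        rw [pow_succ]
        push_cast
        linarith
    have := key N
    have := hG N
    push_cast
    linarith
end


section
variable {Ω : Type*} [MeasurableSpace Ω] {μ : Measure Ω} [IsProbabilityMeasure μ] {n : ℕ}
  {φ : Fin n → Ω → ℂ} {L : ℝ}

theorem Sys.class_cover (h : Sys μ φ L) (hn : 16 ≤ n) {l K : ℝ} (hl : l = 96 * L^2) (hK : 0 < K)
    (hS : Real.exp 1 ≤ K^2 / l) (k : ℕ) {D s : ℝ} {W : Type*} (f w : W → CE n)
    (hw : ∀ i, NearMin μ φ l K (1 / (480000 * (L * K)) * 2^k) (1 / Real.log n) (f i) (w i))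
    (hd : ∀ i j, dd (f i) (f j) ≤ D) (hQ : ∀ i j, QQ (f i - f j) ≤ D) (hs : ∀ i, ss (f i) (w i) ≤ s) :
    ∃ c : W → ℕ, (∀ i, c i < ⌊Real.exp (1444 * (4^k * Real.log n) * Real.log (K^2/l))⌋₊) ∧
      ∀ i j, c i = c j → dd (f i) (f j) ≤ D / 4 + 7 * s + 28860 * (L * K / (2^k * Real.log n)) ∧
        QQ (f i - f j) ≤ D / 4 + 7 * s + 28860 * (L * K / (2^k * Real.log n)) := by
  rcases isEmpty_or_nonempty W with hW | ⟨⟨i0⟩⟩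
  · exact ⟨fun _ => 0, fun i => hW.elim i, fun i => hW.elim i⟩
  have hL := h.one_le
  have hl0 : 0 < l := by rw [hl]; positivity
  have hlogn : 1 ≤ Real.log n := by
    rw [Real.le_log_iff_exp_le (by positivity)]
    have := Real.exp_one_lt_d9
    have : (16:ℝ) ≤ n := by exact_mod_cast hn
    linarith
  set lg := Real.log n with hlg
  set X := L * K with hX
  have hX0 : 0 < X := by positivity
  set t := 1 / (480000 * X) * 2^k with ht
  have ht0 : 0 < t := by positivity
  have hD0 : 0 ≤ D := (dd_nonneg _ _).trans (hd i0 i0)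
  have hs0 : 0 ≤ s := (ss_nonneg _ _).trans (hs i0)
  set R := 54 * t * (D + s) + 12 * (1 / lg) with hR
  have hR0 : 0 < R := by positivity
  have hrr : Real.sqrt R ^ 2 = R := Real.sq_sqrt hR0.le
  set r := Real.sqrt R with hr
  have hr0 : 0 < r := Real.sqrt_pos.2 hR0
  have hcl := fun i => h.near_close hl0 hK ht0.le (hw i) (hw i0) (hd i i0) (hQ i i0) (hs i) (hs i0)
  have hn2 : ∀ i, ‖w i - w i0‖ ≤ K * r := by
    intro i
    refine (sq_le_sq₀ (norm_nonneg _) (by positivity)).1 ?_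
    rw [mul_pow, hrr]
    exact (hcl i).2
  have h4k : (1:ℝ) ≤ 4^k := one_le_pow₀ (by norm_num)
  have hm : lg ≤ 4^k * lg := by nlinarith
  obtain ⟨M, hM, c, hc, hcc⟩ := h.cover hn hl hK hr0 hS hm (hw i0).1 w (fun i => (hw i).1) (fun i => by rw [hrr]; exact (hcl i).1) hn2
  refine ⟨c, fun i => (hc i).trans_le (Nat.le_floor hM), fun i j hij => ?_⟩
  obtain ⟨c1, c2⟩ := hcc i j hij
  set q : ℝ := 1 / 2^k with hq
  have hq0 : 0 < q := by positivity
  have hq4 : (4:ℝ)^k = 1 / q^2 := by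
    rw [hq]; rw [div_pow, one_pow, one_div_one_div, ← pow_mul, mul_comm, pow_mul]; norm_num
  have hA : ∀ a, ‖w i a - w j a‖ ≤ 222 * q * L * r := by
    intro a
    refine (sq_le_sq₀ (norm_nonneg _) (by positivity)).1 ?_
    refine (c2 a).trans ?_
    have e : 512 * r^2 * l * lg / (4^k * lg) = 49152 * (q * L * r)^2 := by
      rw [hl, hq4]; field_simp; ring
    rw [e]
    nlinarith [sq_nonneg (q * L * r)]
  have hsq : Real.sqrt (∑ a, ‖w i0 a‖^2 * ‖w i a - w j a‖^2) ≤ 111 * q * X * r * Real.sqrt (1 / lg) := by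
    apply Real.sqrt_le_iff.2 ⟨by positivity, ?_⟩
    refine c1.trans ?_
    have e : 128 * r^2 * l * K^2 / (4^k * lg) = 12288 * (q * X * r)^2 * (1 / lg) := by
      rw [hl, hq4, hX]; field_simp; ring
    have e2 : (111 * q * X * r * Real.sqrt (1 / lg))^2 = 12321 * (q * X * r)^2 * (1 / lg) := by
      rw [mul_pow, Real.sq_sqrt (by positivity)]; ring
    rw [e, e2]
    gcongr; norm_num
  have hsum : ‖w i - w i0‖ + ‖w j - w i0‖ ≤ 2 * (K * r) := by linarith [hn2 i, hn2 j]
  have hA0 : 0 ≤ 222 * q * L * r := by positivity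
  set B := 555 * q * X * (R + 1 / lg) with hB
  have hdd : dd (w i) (w j) ≤ B := by
    refine (dd_le (w i) (w j) (w i0) hA0 hA).trans ?_
    have am : 2 * (r * Real.sqrt (1 / lg)) ≤ R + 1 / lg := by
      have := sq_nonneg (r - Real.sqrt (1 / lg))
      have e3 := Real.sq_sqrt (by positivity : 0 ≤ 1 / lg)
      nlinarith
    calc _ ≤ 2 * (111 * q * X * r * Real.sqrt (1/lg)) + 222 * q * L * r * (2 * (K * r)) := by gcongr
      _ = 111 * (q * X) * (2 * (r * Real.sqrt (1/lg))) + 444 * (q * X) * r^2 := by rw [hX]; ring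
      _ ≤ 111 * (q * X) * (R + 1 / lg) + 444 * (q * X) * (R + 1 / lg) := by
          rw [hrr]
          have : R ≤ R + 1 / lg := by linarith [show 0 ≤ 1 / lg by positivity]
          gcongr
      _ = B := by rw [hB]; ring
  have hQQ : QQ (w i - w j) ≤ B := by
    refine (QQ_le _ hA0 (fun a => hA a)).trans ?_
    have : ‖w i - w j‖ ≤ 2 * (K * r) := by
      have := norm_sub_le (w i - w i0) (w j - w i0)
      rw [sub_sub_sub_cancel_right] at this
      linarith
    calc _ ≤ 222 * q * L * r * (2 * (K * r)) := by gcongr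
      _ = 444 * (q * X) * r^2 := by rw [hX]; ring
      _ ≤ 555 * (q * X) * (R + 1 / lg) := by
          rw [hrr]
          have : R ≤ R + 1 / lg := by linarith [show 0 ≤ 1 / lg by positivity]
          gcongr; norm_num
      _ = B := by rw [hB]; ring
  have hBe : 4 * B ≤ (D + s) / 4 + 28860 * (X / (2^k * lg)) := by
    have e1 : q * X * t = 1 / 480000 := by rw [hq, ht]; field_simp
    have e2 : X / (2^k * lg) = q * X * (1 / lg) := by rw [hq]; field_simp
    rw [e2, hB, hR]
    have e3 : 4 * (555 * q * X * (54 * t * (D + s) + 12 * (1 / lg) + 1 / lg)) =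
        119880 * (q * X * t) * (D + s) + 28860 * (q * X * (1/lg)) := by ring
    rw [e3, e1]
    linarith
  have si := hs i
  have sj := hs j
  have ni := dd_nonneg (f i) (w i)
  have nj := dd_nonneg (f j) (w j)
  have mi := QQ_nonneg (f i - w i)
  have mj := QQ_nonneg (f j - w j)
  have B0 : 0 ≤ B := by positivity
  unfold ss at si sj
  constructor
  · have a1 := dd_triangle (f i) (w i) (f j)
    have a2 := dd_triangle (w i) (w j) (f j)
    rw [dd_comm (w j)] at a2
    linarith
  · have a1 := QQ_tri (f i) (w i) (f j)
    have a2 := QQ_tri (w i) (w j) (f j)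
    rw [QQ_sub_comm (w j)] at a2
    linarith

/-- radii of the partition -/
noncomputable def DR (X lg : ℝ) (s : ℕ → ℝ) : ℕ → ℝ
  | 0 => 4 * X
  | k+1 => DR X lg s k / 4 + 7 * ((⌊s k / (X / (2^k * lg))⌋₊ + 1) * (X / (2^k * lg))) + 28860 * (X / (2^k * lg))

theorem DR_sum {X lg : ℝ} (hX : 0 < X) (hlg : 0 < lg) (s : ℕ → ℝ) (hs : ∀ k, 0 ≤ s k) (N : ℕ) :
    ∑ k ∈ Finset.range (N+1), 2^k * DR X lg s k + 2^N * DR X lg s N ≤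
      2 * (4 * X + 14 * ∑ k ∈ Finset.range N, 2^k * s k + 57734 * N * (X / lg)) := by
  induction N with
  | zero => simp [DR]; linarith
  | succ N ih =>
    have e : 2^(N+1) * DR X lg s (N+1) ≤ 1/2 * (2^N * DR X lg s N) + 14 * (2^N * s N) + 57734 * (X / lg) := by
      have hσ : 0 < X / (2^N * lg) := by positivity
      have h1 : (⌊s N / (X / (2^N * lg))⌋₊ + 1) * (X / (2^N * lg)) ≤ s N + X / (2^N * lg) := by
        have := Nat.floor_le (div_nonneg (hs N) hσ.le)
        rw [le_div_iff₀ hσ] at this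
        linarith
      have e2 : (2:ℝ)^N * (X / (2^N * lg)) = X / lg := by field_simp
      rw [DR, pow_succ]
      have h2 := mul_le_mul_of_nonneg_left h1 (by positivity : (0:ℝ) ≤ 2^N)
      nlinarith
    rw [Finset.sum_range_succ _ (N+1), Finset.sum_range_succ (fun k => 2^k * s k) N]
    push_cast
    linarith

theorem mixed_lt {a b A B : ℕ} (ha : a < A) (hb : b < B) : a * B + b < A * B := by
  nlinarith

theorem mixed_inj {a b a' b' B : ℕ} (hb : b < B) (hb' : b' < B) (h : a * B + b = a' * B + b') : a = a' ∧ b = b' := by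
  have hB : 0 < B := by omega
  have h1 : (a * B + b) / B = a := by rw [mul_comm, Nat.mul_add_div hB, Nat.div_eq_of_lt hb, add_zero]
  have h2 : (a' * B + b') / B = a' := by rw [mul_comm, Nat.mul_add_div hB, Nat.div_eq_of_lt hb', add_zero]
  have : a = a' := by rw [← h1, h, h2]
  subst this
  exact ⟨rfl, by omega⟩

theorem Sys.codes (h : Sys μ φ L) (hn : 16 ≤ n) {l K : ℝ} (hl : l = 96 * L^2) (hK : 0 < K)
    (hS : Real.exp 1 ≤ K^2 / l) (w : ℕ → BB μ φ K → CE n)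
    (hw : ∀ k (i : BB μ φ K), NearMin μ φ l K (1 / (480000 * (L * K)) * 2^k) (1 / Real.log n) (i : CE n) (w k i)) (k : ℕ) :
    ∃ (M : ℕ) (c : BB μ φ K → ℕ), (k = 0 → M = 1) ∧
      (M:ℝ) ≤ Real.exp (500 * (3 + Real.log (1 + K^2/l)) * Real.log n * 4^k) ∧ (∀ i, c i < M) ∧
      ∀ i j : BB μ φ K, c i = c j → DR (L * K) (Real.log n) (fun k => ss (i : CE n) (w k i)) k = DR (L * K) (Real.log n) (fun k => ss (j : CE n) (w k j)) k
        ∧ dd (i : CE n) (j : CE n) ≤ DR (L * K) (Real.log n) (fun k => ss (i : CE n) (w k i)) k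
        ∧ QQ ((i : CE n) - (j : CE n)) ≤ DR (L * K) (Real.log n) (fun k => ss (i : CE n) (w k i)) k := by
  have hL := h.one_le
  have hl0 : 0 < l := by rw [hl]; positivity
  have hlogn : 1 ≤ Real.log n := by
    rw [Real.le_log_iff_exp_le (by positivity)]
    have := Real.exp_one_lt_d9
    have : (16:ℝ) ≤ n := by exact_mod_cast hn
    linarith
  set lg := Real.log n with hlg
  set X := L * K with hX
  have hX0 : 0 < X := by positivity
  have hS0 : 0 < K^2 / l := by positivity
  have hlogS : 0 ≤ Real.log (K^2 / l) := Real.log_nonneg (le_trans (by have := Real.add_one_le_exp (1:ℝ); linarith) hS)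
  have hlogle : Real.log (K^2/l) ≤ Real.log (1 + K^2/l) := Real.log_le_log hS0 (by linarith)
  set S' := Real.log (1 + K^2/l) with hS'
  have hS'0 : 0 ≤ S' := hlogS.trans hlogle
  induction k with
  | zero =>
    refine ⟨1, fun _ => 0, fun _ => rfl, ?_, fun _ => by norm_num, fun i j _ => ⟨by simp only [DR], ?_, ?_⟩⟩
    · rw [Nat.cast_one]; exact Real.one_le_exp (by positivity)
    · have := h.dd_BB i.2 j.2
      simp only [DR]; linarith
    · simp only [DR]; exact h.QQ_sub_BB i.2 j.2
  | succ k ih =>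
    obtain ⟨M, c, -, hM, hc, hcc⟩ := ih
    set σ := X / (2^k * lg) with hσ
    have hσ0 : 0 < σ := by positivity
    set bk : BB μ φ K → ℕ := fun i => ⌊ss (i : CE n) (w k i) / σ⌋₊ with hbk
    set R := ⌊Real.exp (1444 * (4^k * lg) * Real.log (K^2/l))⌋₊ with hR
    have hcover : ∀ p : ℕ × ℕ, ∃ c' : BB μ φ K → ℕ, (∀ i, (c i, bk i) = p → c' i < R) ∧
        ∀ i j : BB μ φ K, (c i, bk i) = p → (c j, bk j) = p → c' i = c' j →
          dd (i : CE n) (j : CE n) ≤ DR X lg (fun k => ss (i : CE n) (w k i)) (k+1) ∧ QQ ((i : CE n) - (j : CE n)) ≤ DR X lg (fun k => ss (i : CE n) (w k i)) (k+1) := by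
      intro p
      classical
      by_cases hne : ∃ i0, (c i0, bk i0) = p
      swap
      · push Not at hne
        exact ⟨fun _ => 0, fun i hi => absurd hi (hne i), fun i _ hi => absurd hi (hne i)⟩
      obtain ⟨i0, hi0⟩ := hne
      have hDi : ∀ i, (c i, bk i) = p → DR X lg (fun k => ss (i : CE n) (w k i)) k = DR X lg (fun k => ss (i0 : CE n) (w k i0)) k := by
        intro i hi
        have : c i = c i0 := by rw [← hi0] at hi; exact (Prod.ext_iff.1 hi).1
        exact (hcc i i0 this).1
      obtain ⟨c', hc', hcc'⟩ := h.class_cover hn hl hK hS k (D := DR X lg (fun k => ss (i0 : CE n) (w k i0)) k) (s := (bk i0 + 1) * σ)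
        (W := {i : BB μ φ K // (c i, bk i) = p}) (fun i => (i.1 : CE n)) (fun i => w k i.1) (fun i => hw k i.1)
        (fun i j => by
          have hij : c i.1 = c j.1 := by have := i.2.trans j.2.symm; exact (Prod.ext_iff.1 this).1
          have := (hcc i.1 j.1 hij).2.1
          rwa [hDi i.1 i.2] at this)
        (fun i j => by
          have hij : c i.1 = c j.1 := by have := i.2.trans j.2.symm; exact (Prod.ext_iff.1 this).1
          have := (hcc i.1 j.1 hij).2.2
          rwa [hDi i.1 i.2] at this)
        (fun i => by
          have hb : bk i.1 = bk i0 := by have := i.2.trans hi0.symm; exact (Prod.ext_iff.1 this).2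
          have := (Nat.lt_floor_add_one (ss (i.1 : CE n) (w k i.1) / σ)).le
          rw [← hb]
          rw [div_le_iff₀ hσ0] at this
          exact this)
      refine ⟨fun i => if hi : (c i, bk i) = p then c' ⟨i, hi⟩ else 0, fun i hi => ?_, fun i j hi hj hij => ?_⟩
      · simp only [hi, dif_pos]; exact hc' _
      · simp only [hi, hj, dif_pos] at hij
        have hb : bk i = bk i0 := by have := hi.trans hi0.symm; exact (Prod.ext_iff.1 this).2
        have := hcc' ⟨i, hi⟩ ⟨j, hj⟩ hij
        rw [← hDi i hi, ← hb] at this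
        simp only [DR]
        exact this
    choose c' hc' hcc' using hcover
    set Bk := ⌊6 * 2^k * lg⌋₊ + 1 with hBk
    have hbB : ∀ i, bk i < Bk := by
      intro i
      rw [hBk, Nat.lt_succ_iff]
      apply Nat.floor_le_floor
      rw [div_le_iff₀ hσ0]
      have h1 := h.dd_BB i.2 (hw k i).1
      have h2 := h.QQ_sub_BB i.2 (hw k i).1
      have e : 6 * 2^k * lg * σ = 6 * X := by rw [hσ]; field_simp
      rw [e]; unfold ss; linarith
    have hcR : ∀ i, c' (c i, bk i) i < R := fun i => hc' _ i rfl
    refine ⟨(M * Bk) * R, fun i => (c i * Bk + bk i) * R + c' (c i, bk i) i, fun h0 => absurd h0 (by omega), ?_, ?_, ?_⟩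
    · have hB : (Bk:ℝ) ≤ Real.exp (7 * (4^k * lg)) := by
        have h24 : (2:ℝ)^k ≤ 4^k := pow_le_pow_left₀ (by norm_num) (by norm_num) k
        have h1 : (1:ℝ) ≤ 4^k := one_le_pow₀ (by norm_num)
        have h2 : (Bk:ℝ) ≤ 6 * 2^k * lg + 1 := by
          rw [hBk]; push_cast
          have := Nat.floor_le (by positivity : 0 ≤ 6 * 2^k * lg)
          linarith
        have h3 : 6 * 2^k * lg ≤ 6 * 4^k * lg := by gcongr
        have h4 : 1 ≤ 4^k * lg := by nlinarith
        have := Real.add_one_le_exp (7 * (4^k * lg))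
        linarith
      have hRr : (R:ℝ) ≤ Real.exp (1444 * (4^k * lg) * Real.log (K^2/l)) := Nat.floor_le (Real.exp_pos _).le
      push_cast
      calc (M:ℝ) * Bk * R ≤ Real.exp (500 * (3 + S') * lg * 4^k) * Real.exp (7 * (4^k * lg)) *
            Real.exp (1444 * (4^k * lg) * Real.log (K^2/l)) := by gcongr
        _ = Real.exp (500 * (3 + S') * lg * 4^k + 7 * (4^k * lg) + 1444 * (4^k * lg) * Real.log (K^2/l)) := by
            rw [Real.exp_add, Real.exp_add]
        _ ≤ _ := by
            apply Real.exp_le_exp.2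
            have hp : 0 < 4^k * lg := by positivity
            have hlS := mul_le_mul_of_nonneg_left hlogle hp.le
            have := mul_nonneg hp.le hS'0
            rw [pow_succ (4:ℝ) k]
            nlinarith
    · intro i
      exact mixed_lt (mixed_lt (hc i) (hbB i)) (hcR i)
    · intro i j hij
      obtain ⟨e1, e2⟩ := mixed_inj (hcR i) (hcR j) hij
      obtain ⟨e3, e4⟩ := mixed_inj (hbB i) (hbB j) e1
      rw [← e3, ← e4] at e2
      refine ⟨?_, hcc' (c i, bk i) i j rfl (by rw [e3, e4]) e2⟩
      have hD := (hcc i j e3).1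
      simp only [DR]
      have e4' : ⌊ss (i : CE n) (w k i) / (X / (2^k * lg))⌋₊ = ⌊ss (j : CE n) (w k j) / (X / (2^k * lg))⌋₊ := e4
      rw [hD, e4']
end


section
variable {Ω : Type*} [MeasurableSpace Ω] {μ : Measure Ω} [IsProbabilityMeasure μ] {n : ℕ}
  {φ : Fin n → Ω → ℂ} {L : ℝ}

theorem Sys.signs (h : Sys μ φ L) (hn : 16 ≤ n) {l K : ℝ} (hl : l = 96 * L^2) (hK : 0 < K)
    (hS : Real.exp 1 ≤ K^2 / l) :
    ∃ ε : Fin n → ℝ, (∀ i, ε i = 1 ∨ ε i = -1) ∧ |∑ i, ε i| ≤ 2 * Real.sqrt n ∧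
      ∀ f ∈ BB μ φ K, |∑ i, ε i * ‖f i‖^2| ≤
        7 * Real.sqrt (500 * (3 + Real.log (1 + K^2/l)) * Real.log n) * (50000000 * (L * K) * (3 + Real.log (1 + K^2/l))) := by
  have hL := h.one_le
  have hl0 : 0 < l := by rw [hl]; positivity
  have hlogn : 1 ≤ Real.log n := by
    rw [Real.le_log_iff_exp_le (by positivity)]
    have := Real.exp_one_lt_d9
    have : (16:ℝ) ≤ n := by exact_mod_cast hn
    linarith
  set lg := Real.log n with hlg
  set X := L * K with hX
  have hX0 : 0 < X := by positivity
  have hS0 : 0 < K^2 / l := by positivity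
  set ell := 3 + Real.log (1 + K^2/l) with hell
  have hell3 : 3 ≤ ell := by
    have : 0 ≤ Real.log (1 + K^2/l) := Real.log_nonneg (by linarith)
    linarith
  have hex : ∀ (k : ℕ) (i : BB μ φ K), ∃ w, NearMin μ φ l K (1 / (480000 * X) * 2^k) (1 / lg) (i : CE n) w :=
    fun k i => exists_nearMin hl0 hK (by positivity) (by positivity) _
  choose w hw using hex
  choose M c hM0 hMe hc hcc using h.codes hn hl hK hS w hw
  have hn4 : n ≤ 4^⌈lg⌉₊ := by
    have h1 : (n:ℝ) ≤ 4^⌈lg⌉₊ := by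
      have hnpos : (0:ℝ) < n := by positivity
      calc (n:ℝ) = Real.exp lg := (Real.exp_log hnpos).symm
        _ ≤ Real.exp ⌈lg⌉₊ := Real.exp_le_exp.2 (Nat.le_ceil _)
        _ = (Real.exp 1)^⌈lg⌉₊ := by rw [← Real.exp_nat_mul, mul_one]
        _ ≤ 4^⌈lg⌉₊ := by
          have := Real.exp_one_lt_d9
          gcongr; linarith
    exact_mod_cast h1
  obtain ⟨ε, h1, h2, h3⟩ := chaining (T := BB μ φ K) (Nl := ⌈lg⌉₊) (fun i => yy (i : CE n)) ⟨0, zero_mem_BB hK.le⟩ yy_zero M c hc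
    (fun k i => DR X lg (fun k => ss (i : CE n) (w k i)) k) (fun k f g hfg => (hcc k f g hfg).2.1) (500 * ell * lg)
    (by nlinarith) hMe (hM0 0 rfl) hn4
  refine ⟨ε, h1, h2, fun f hf => (h3 ⟨f, hf⟩).trans ?_⟩
  have hNl : (⌈lg⌉₊ : ℝ) ≤ 2 * lg := by
    have := (Nat.ceil_lt_add_one (by positivity : 0 ≤ lg)).le
    linarith
  gcongr
  set s : ℕ → ℝ := fun k => ss f (w k ⟨f, hf⟩) with hs
  have hs0 : ∀ k, 0 ≤ s k := fun k => ss_nonneg _ _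
  have hDR := DR_sum hX0 (by positivity : 0 < lg) s hs0 ⌈lg⌉₊
  have hDR0 : 0 ≤ 2^⌈lg⌉₊ * DR X lg s ⌈lg⌉₊ := by
    have := (dd_nonneg f f).trans (hcc ⌈lg⌉₊ ⟨f, hf⟩ ⟨f, hf⟩ rfl).2.1
    exact mul_nonneg (by positivity) this
  have hss := h.sum_s hl0 hK (by positivity : 0 ≤ 1 / (480000 * X)) hf (fun k => w k ⟨f, hf⟩) (fun k => hw k ⟨f, hf⟩) ⌈lg⌉₊
  rw [← hell] at hss
  have e1 : ∑ k ∈ Finset.range ⌈lg⌉₊, 1 / (480000 * X) * 2^k * ss f (w k ⟨f, hf⟩) = 1 / (480000 * X) * ∑ k ∈ Finset.range ⌈lg⌉₊, 2^k * s k := by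
    rw [Finset.mul_sum]
    refine Finset.sum_congr rfl (fun k _ => ?_)
    rw [mul_assoc]
  rw [e1] at hss
  have e2 : 2 * (⌈lg⌉₊:ℝ) * (1 / lg) ≤ 4 := by
    rw [mul_one_div, div_le_iff₀ (by positivity)]; linarith
  have e3 : (⌈lg⌉₊:ℝ) * (X / lg) ≤ 2 * X := by
    rw [mul_div_assoc', div_le_iff₀ (by positivity)]; nlinarith
  have e4 : ∑ k ∈ Finset.range ⌈lg⌉₊, 2^k * s k ≤ 480000 * X * (2 * ell + 4) := by
    have : 1 / (480000 * X) * ∑ k ∈ Finset.range ⌈lg⌉₊, 2^k * s k ≤ 2 * ell + 4 := by linarith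
    rw [one_div, inv_mul_le_iff₀ (by positivity)] at this
    exact this
  have e5 : 3 * X ≤ ell * X := by gcongr
  show ∑ k ∈ Finset.range (⌈lg⌉₊ + 1), 2^k * DR X lg s k ≤ _
  nlinarith

theorem Sys.signs' (h : Sys μ φ L) (hn : 16 ≤ n) {K : ℝ}
    (hKd : K = 10^14 * L * Real.sqrt (Real.log n) * Real.log (Real.log n) ^ ((5:ℝ)/2)) :
    0 < K ∧ ∃ ε : Fin n → ℝ, (∀ i, ε i = 1 ∨ ε i = -1) ∧ |∑ i, ε i| ≤ 2 * Real.sqrt n ∧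
      ∀ f ∈ BB μ φ K, |∑ i, ε i * ‖f i‖^2| ≤ K^2 / 2 := by
  have hL := h.one_le
  have hL0 : 0 < L := by linarith
  have h16 : (16:ℝ) ≤ n := by exact_mod_cast hn
  have hlge : Real.exp 1 ≤ Real.log n := by
    have h1 : Real.log 16 ≤ Real.log n := Real.log_le_log (by norm_num) h16
    have h2 : Real.log 16 = 4 * Real.log 2 := by
      rw [show (16:ℝ) = 2^4 by norm_num, Real.log_pow]; norm_num
    have := Real.log_two_gt_d9
    have := Real.exp_one_lt_d9
    linarith
  have hlg0 : 0 < Real.log n := (Real.exp_pos 1).trans_le hlge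
  have hq1 : 1 ≤ Real.log (Real.log n) := (Real.le_log_iff_exp_le hlg0).2 hlge
  set lg := Real.log n with hlg
  set q := Real.log lg with hq
  have hq0 : 0 < q := by linarith
  have hlgq : lg = Real.exp q := (Real.exp_log hlg0).symm
  have hq5 : q ^ ((5:ℝ)/2) = q^2 * Real.sqrt q := by
    rw [show (5:ℝ)/2 = (2:ℕ) + 1/2 by norm_num, Real.rpow_add hq0, Real.rpow_natCast, ← Real.sqrt_eq_rpow]
  have hlgs := Real.sq_sqrt hlg0.le
  have hqs := Real.sq_sqrt hq0.le
  have hK0 : 0 < K := by rw [hKd]; positivity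
  have hK2 : K^2 = 10^28 * L^2 * lg * q^5 := by
    rw [hKd, hq5]
    calc _ = 10^28 * L^2 * (Real.sqrt lg ^2) * (q^4 * Real.sqrt q ^ 2) := by ring
      _ = _ := by rw [hlgs, hqs]; ring
  set l := 96 * L^2 with hl
  have hl0 : 0 < l := by positivity
  have hSl : K^2 / l = 10^28 / 96 * lg * q^5 := by
    rw [hK2, hl]; field_simp
  have hq51 : 1 ≤ q^5 := one_le_pow₀ hq1
  have hS : Real.exp 1 ≤ K^2 / l := by
    rw [hSl]
    have : Real.exp 1 ≤ lg * 1 := by linarith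
    have h2 : lg * 1 ≤ lg * q^5 := by gcongr
    have h3 : 0 < lg * q^5 := by positivity
    nlinarith
  refine ⟨hK0, ?_⟩
  obtain ⟨ε, h1, h2, h3⟩ := h.signs hn hl hK0 hS
  refine ⟨ε, h1, h2, fun f hf => (h3 f hf).trans ?_⟩
  -- bound on the logarithm
  have hell : 3 + Real.log (1 + K^2/l) ≤ 81 * q := by
    have hlog : Real.log (1 + K^2/l) ≤ 70 + 3 * q := by
      rw [Real.log_le_iff_le_exp (by positivity), hSl]
      have e1 : q^5 ≤ 120 * Real.exp q := by
        have := Real.pow_div_factorial_le_exp q hq0.le 5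
        rw [div_le_iff₀ (by positivity)] at this
        norm_num [Nat.factorial] at this
        linarith
      have e0 : 1 ≤ Real.exp q := Real.one_le_exp hq0.le
      have e2 : Real.exp (70 + 3*q) = Real.exp 70 * (Real.exp q * Real.exp q * Real.exp q) := by
        rw [← Real.exp_add, ← Real.exp_add, ← Real.exp_add]; congr 1; ring
      have e3 : (10:ℝ)^30 ≤ Real.exp 70 := by
        have e : Real.exp 70 = (Real.exp 1)^70 := by rw [← Real.exp_nat_mul]; norm_num
        rw [e]
        have := Real.exp_one_gt_d9
        calc (10:ℝ)^30 ≤ (2.7:ℝ)^70 := by norm_num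
          _ ≤ _ := by gcongr; linarith
      rw [e2, hlgq]
      set E := Real.exp q with hE
      calc 1 + 10^28/96 * E * q^5 ≤ 1 * (1 * 1) + 10^28/96 * E * (120 * E) := by gcongr; norm_num
        _ ≤ E * (E * E) + (10^29 - 1) * (E * (E * E)) := by
            have : E * E ≤ E * (E * E) := by nlinarith
            have h1 : 1 ≤ E * E := by nlinarith
            nlinarith
        _ = 10^29 * (E * E * E) := by ring
        _ ≤ Real.exp 70 * (E * E * E) := by gcongr; linarith
    linarith
  set ell := 3 + Real.log (1 + K^2/l) with helld
  have hell0 : 0 ≤ ell := by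
    have : 0 ≤ Real.log (1 + K^2/l) := Real.log_nonneg (by have : 0 < K^2/l := by positivity
                                                           linarith)
    linarith
  have hsq : Real.sqrt (500 * ell * lg) ≤ 202 * (Real.sqrt lg * Real.sqrt q) := by
    apply Real.sqrt_le_iff.2 ⟨by positivity, ?_⟩
    calc 500 * ell * lg ≤ 500 * (81 * q) * lg := by gcongr
      _ ≤ 202^2 * (lg * q) := by nlinarith [mul_pos hq0 hlg0]
      _ = 202^2 * (Real.sqrt lg ^2 * Real.sqrt q ^ 2) := by rw [hlgs, hqs]
      _ = _ := by ring
  calc _ ≤ 7 * (202 * (Real.sqrt lg * Real.sqrt q)) * (50000000 * (L * K) * (81 * q)) := by gcongr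
    _ = 5726700000000 * (K * (L * Real.sqrt lg * (q^1 * Real.sqrt q))) := by ring
    _ ≤ 50000000000000 * (K * (L * Real.sqrt lg * (q^2 * Real.sqrt q))) := by
        have : q^1 ≤ q^2 := by nlinarith
        gcongr; norm_num
    _ = K * (10^14 * L * Real.sqrt lg * (q^2 * Real.sqrt q)) / 2 := by ring
    _ = K * K / 2 := by rw [← hq5, ← hKd]
    _ = _ := by ring
end


section
variable {Ω : Type*} [MeasurableSpace Ω] {μ : Measure Ω} [IsProbabilityMeasure μ] {n : ℕ}
  {φ : Fin n → Ω → ℂ} {L : ℝ}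

theorem exists_sys (hn : 16 ≤ n) (hm : ∀ j, AEStronglyMeasurable (φ j) μ)
    (ho : ∀ i j, (∫ ω, (starRingEnd ℂ) (φ i ω) * φ j ω ∂μ) = if i = j then 1 else 0)
    (hb : ∀ j, ∀ᵐ ω ∂μ, ‖φ j ω‖ ≤ L) : ∃ ψ : Fin n → Ω → ℂ, Sys μ ψ L ∧ ∀ j, φ j =ᵐ[μ] ψ j := by
  let i0 : Fin n := ⟨0, by omega⟩
  have hL0 : 0 ≤ L := by
    obtain ⟨ω, hω⟩ := (hb i0).exists
    exact (norm_nonneg _).trans hω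
  have hL1 : 1 ≤ L := by
    have h1 := ho i0 i0
    have h2 : ‖∫ ω, (starRingEnd ℂ) (φ i0 ω) * φ i0 ω ∂μ‖ ≤ (L * L) * μ.real Set.univ := by
      apply norm_integral_le_of_norm_le_const
      filter_upwards [hb i0] with ω hω
      rw [norm_mul, RCLike.norm_conj]
      gcongr
    rw [h1] at h2
    simp at h2
    nlinarith
  classical
  refine ⟨fun j ω => if ‖(hm j).mk (φ j) ω‖ ≤ L then (hm j).mk (φ j) ω else 0, ?_, ?_⟩
  swap
  · intro j
    filter_upwards [(hm j).ae_eq_mk, hb j] with ω h1 h2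
    rw [h1] at h2
    rw [if_pos h2, h1]
  · have hae : ∀ j, φ j =ᵐ[μ] (fun ω => if ‖(hm j).mk (φ j) ω‖ ≤ L then (hm j).mk (φ j) ω else 0) := by
      intro j
      filter_upwards [(hm j).ae_eq_mk, hb j] with ω h1 h2
      rw [h1] at h2
      rw [if_pos h2, h1]
    refine ⟨fun j => ?_, fun j ω => ?_, fun i j => ?_, hL1⟩
    · have hmm := (hm j).stronglyMeasurable_mk.measurable
      exact Measurable.ite (measurableSet_le hmm.norm measurable_const) hmm measurable_const
    · split_ifs with hc
      · exact hc
      · simpa using hL0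
    · rw [← ho i j]
      apply integral_congr_ae
      filter_upwards [hae i, hae j] with ω h1 h2
      rw [h1, h2]

theorem Sys.eLp2 (h : Sys μ φ L) (a : CE n) : eLpNorm (ff φ a) 2 μ = ENNReal.ofReal ‖a‖ := by
  have hM : MemLp (ff φ a) 2 μ := MemLp.of_bound (h.ff_meas a).aestronglyMeasurable _ (Filter.Eventually.of_forall (h.ff_bdd a))
  rw [hM.eLpNorm_eq_integral_rpow_norm (by norm_num) (by norm_num)]
  have e : ∀ ω, ‖ff φ a ω‖ ^ (ENNReal.toReal 2) = ‖ff φ a ω‖^2 := by intro ω; simp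
  simp_rw [e]
  rw [h.norm_sq]
  congr 1
  simp only [ENNReal.toReal_ofNat]
  rw [← one_div, ← Real.sqrt_eq_rpow, Real.sqrt_sq (norm_nonneg _)]

theorem Sys.eLp1 (h : Sys μ φ L) (a : CE n) : eLpNorm (ff φ a) 1 μ = ENNReal.ofReal (N1 μ φ a) := by
  have hI : Integrable (ff φ a) μ := integrable_of_bdd (h.ff_meas a) _ (h.ff_bdd a)
  rw [eLpNorm_one_eq_lintegral_enorm, N1, ofReal_integral_norm_eq_lintegral_enorm hI]

theorem Sys.side (h : Sys μ φ L) {K : ℝ} (hK : 0 < K) (ε : Fin n → ℝ)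
    (hε : ∀ f ∈ BB μ φ K, |∑ i, ε i * ‖f i‖^2| ≤ K^2 / 2) (δ : ℝ) (hδ : |δ| = 1) (b : CE n)
    (hb : ∀ i, ε i = δ ∨ b i = 0) : ‖b‖ ≤ K * N1 μ φ b := by
  by_contra hc
  push Not at hc
  have hN := N1_nonneg (μ := μ) (φ := φ) b
  have hb0 : 0 < ‖b‖ := lt_of_le_of_lt (by positivity) hc
  set f := (K / ‖b‖) • b with hf
  have hfn : ‖f‖ = K := by
    rw [hf, norm_smul, Real.norm_of_nonneg (by positivity)]; field_simp
  have hfB : f ∈ BB μ φ K := by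
    refine ⟨?_, hfn.le⟩
    rw [hf, N1_smul, abs_of_nonneg (by positivity), div_mul_eq_mul_div, div_le_one hb0]
    exact hc.le
  have h1 := hε f hfB
  have e : ∑ i, ε i * ‖f i‖^2 = δ * K^2 := by
    rw [← hfn, EuclideanSpace.norm_sq_eq, Finset.mul_sum]
    refine Finset.sum_congr rfl (fun i _ => ?_)
    rcases hb i with h2 | h2
    · rw [h2]
    · simp [hf, h2]
  rw [e, abs_mul, hδ, one_mul, abs_of_nonneg (by positivity)] at h1
  have : 0 < K^2 := by positivity
  linarith

theorem Sys.side_eLp {ψ : Fin n → Ω → ℂ} (h : Sys μ ψ L) (hψ : ∀ j, φ j =ᵐ[μ] ψ j) {K : ℝ} (hK : 0 < K) (ε : Fin n → ℝ)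
    (hε : ∀ f ∈ BB μ ψ K, |∑ i, ε i * ‖f i‖^2| ≤ K^2 / 2) (δ : ℝ) (hδ : |δ| = 1) (J : Finset (Fin n))
    (hJ : ∀ i ∈ J, ε i = δ) (a : Fin n → ℂ) :
    eLpNorm (fun ω => ∑ i ∈ J, a i * φ i ω) 2 μ ≤ ENNReal.ofReal K * eLpNorm (fun ω => ∑ i ∈ J, a i * φ i ω) 1 μ := by
  classical
  set b : CE n := WithLp.toLp 2 (fun i => if i ∈ J then a i else 0) with hb
  have hae : (fun ω => ∑ i ∈ J, a i * φ i ω) =ᵐ[μ] ff ψ b := by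
    have : ∀ᵐ ω ∂μ, ∀ j, φ j ω = ψ j ω := ae_all_iff.2 hψ
    filter_upwards [this] with ω hω
    simp [ff, hb, hω, Finset.sum_ite_mem]
  rw [eLpNorm_congr_ae hae, eLpNorm_congr_ae hae, h.eLp2, h.eLp1, ← ENNReal.ofReal_mul hK.le]
  apply ENNReal.ofReal_le_ofReal
  refine h.side hK ε hε δ hδ b (fun i => ?_)
  by_cases hi : i ∈ J
  · exact Or.inl (hJ i hi)
  · right; simp [hb, hi]
end

theorem stmt9 :
    ∃ c C : ℝ, 0 < c ∧ 0 < C ∧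
      ∀ (Ω : Type*) [MeasurableSpace Ω] (P : Measure Ω) [IsProbabilityMeasure P]
        (n : ℕ), 16 ≤ n → Even n →
        ∀ (φ : Fin n → Ω → ℂ) (L : ℝ),
        (∀ j, AEStronglyMeasurable (φ j) P) →
        (∀ i j, (∫ ω, (starRingEnd ℂ) (φ i ω) * φ j ω ∂P) = if i = j then 1 else 0) →
        (∀ j, ∀ᵐ ω ∂P, ‖φ j ω‖ ≤ L) →
        ∃ I : Finset (Fin n),
          (n : ℝ) / 2 - c * Real.sqrt n ≤ I.card ∧
          (I.card : ℝ) ≤ (n : ℝ) / 2 + c * Real.sqrt n ∧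
          ∀ a : Fin n → ℂ,
            eLpNorm (fun ω => ∑ i ∈ I, a i * φ i ω) 2 P ≤
              ENNReal.ofReal
                  (C * L * Real.sqrt (Real.log n) *
                    Real.log (Real.log n) ^ ((5 : ℝ) / 2)) *
                eLpNorm (fun ω => ∑ i ∈ I, a i * φ i ω) 1 P ∧
            eLpNorm (fun ω => ∑ i ∈ Iᶜ, a i * φ i ω) 2 P ≤
              ENNReal.ofReal
                  (C * L * Real.sqrt (Real.log n) *
                    Real.log (Real.log n) ^ ((5 : ℝ) / 2)) *
                eLpNorm (fun ω => ∑ i ∈ Iᶜ, a i * φ i ω) 1 P := by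
  refine ⟨1, 10^14, by norm_num, by norm_num, ?_⟩
  intro Ω _ P _ n hn _ φ L hm ho hb
  classical
  obtain ⟨ψ, hsys, hψ⟩ := exists_sys hn hm ho hb
  obtain ⟨hK, ε, h1, h2, h3⟩ := hsys.signs' hn rfl
  set I : Finset (Fin n) := Finset.univ.filter (fun i => ε i = 1) with hI
  have hsum : ∑ i, ε i = 2 * I.card - n := by
    have e : ∀ i, ε i = 2 * (if ε i = 1 then 1 else 0) - 1 := by
      intro i
      rcases h1 i with h | h <;> rw [h] <;> norm_num
    rw [Finset.sum_congr rfl (fun i _ => e i), Finset.sum_sub_distrib, ← Finset.mul_sum]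
    simp [hI]
  rw [hsum, abs_le] at h2
  refine ⟨I, by linarith [h2.1], by linarith [h2.2], fun a => ⟨?_, ?_⟩⟩
  · exact hsys.side_eLp hψ hK ε h3 1 (by simp) I (fun i hi => by simpa [hI] using hi) a
  · refine hsys.side_eLp hψ hK ε h3 (-1) (by simp) Iᶜ (fun i hi => ?_) a
    rcases h1 i with h | h
    · simp [hI, h] at hi
    · exact h
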